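/- arXiv:0801.0586 — 2 statements merged into one kernel-verified Lean document; each statement's English description precedes it below -/
import Mathlib

section
/- Let f_1,…,f_m ∈ ℝ[x_1,…,x_n]. There exists a nonzero polynomial q, with real coefficients, in the n² entries of an n×n matrix, such that every matrix V ∈ ℚ^{n×n} with q(V) ≠ 0 is invertible and has the following property. For every set 𝒫 ⊆ ℝⁿ belonging to the Boolean algebra of subsets of ℝⁿ generated by the sets {x : f_i(Vx) > 0} and {x : f_i(Vx) = 0} (1 ≤ i ≤ m), every point p = (p_1,…,p_n) ∈ ℝⁿ, every 1 ≤ k ≤ n, and every connected component C of 𝒫 ∩ {x : x_1 = p_1, …, x_{k−1} = p_{k−1}}: the set Z(C,k) is finite; moreover, if π_k(C) is bounded from below then Z_inf(C,k) ≠ ∅, and if π_k(C) is bounded from above then Z_sup(C,k) ≠ ∅. -/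
open MvPolynomial Set

/-- Membership in the Boolean algebra of subsets generated by a family `G`:
the smallest collection containing `G` and closed under complements, finite
unions and finite intersections. -/
inductive InBoolAlg {α : Type*} (G : Set (Set α)) : Set α → Prop
  | basic (s : Set α) : s ∈ G → InBoolAlg G s
  | compl (s : Set α) : InBoolAlg G s → InBoolAlg G sᶜ
  | union (s t : Set α) : InBoolAlg G s → InBoolAlg G t → InBoolAlg G (s ∪ t)
  | inter (s t : Set α) : InBoolAlg G s → InBoolAlg G t → InBoolAlg G (s ∩ t)

/-- The projection `π_k` of a subset of `ℝⁿ` to its `k`-th coordinate. -/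
def projK {n : ℕ} (k : Fin n) (A : Set (Fin n → ℝ)) : Set ℝ := (fun x => x k) '' A

/-- `Z_inf(A,k)`: points of the closure of `A` whose `k`-th coordinate equals
`inf π_k(A)`, when `π_k(A)` is bounded from below; empty otherwise. -/
def Zinf {n : ℕ} (A : Set (Fin n → ℝ)) (k : Fin n) : Set (Fin n → ℝ) :=
  {x | x ∈ closure A ∧ BddBelow (projK k A) ∧ x k = sInf (projK k A)}

/-- `Z_sup(A,k)`: points of the closure of `A` whose `k`-th coordinate equals
`sup π_k(A)`, when `π_k(A)` is bounded from above; empty otherwise. -/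
def Zsup {n : ℕ} (A : Set (Fin n → ℝ)) (k : Fin n) : Set (Fin n → ℝ) :=
  {x | x ∈ closure A ∧ BddAbove (projK k A) ∧ x k = sSup (projK k A)}

/-- `Z(A,k) = Z_inf(A,k) ∪ Z_sup(A,k)`. -/
def ZZ {n : ℕ} (A : Set (Fin n → ℝ)) (k : Fin n) : Set (Fin n → ℝ) := Zinf A k ∪ Zsup A k

open Topology

/-- The finite set of complex roots of a real polynomial. -/
noncomputable def complexRoots (p : Polynomial ℝ) : Finset ℂ :=
  (p.map Complex.ofRealHom).roots.toFinset

/-- A family of real polynomials of degree `d` with continuous coefficients and constant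
nonzero leading coefficient `c`. -/
structure IsContinuousFamily {T : Type*} [TopologicalSpace T] (φ : T → Polynomial ℝ) (d : ℕ)
    (c : ℝ) : Prop where
  ne_zero : c ≠ 0
  natDegree_le : ∀ t, (φ t).natDegree ≤ d
  coeff_eq : ∀ t, (φ t).coeff d = c
  continuous_coeff : ∀ i, Continuous fun t => (φ t).coeff i

namespace IsContinuousFamily

variable {T : Type*} [TopologicalSpace T] {φ p : T → Polynomial ℝ} {d e : ℕ} {c b : ℝ}

lemma poly_ne_zero (h : IsContinuousFamily φ d c) (t : T) : φ t ≠ 0 := fun h0 =>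
  h.ne_zero (by rw [← h.coeff_eq t, h0, Polynomial.coeff_zero])

lemma natDegree_eq (h : IsContinuousFamily φ d c) (t : T) : (φ t).natDegree = d :=
  le_antisymm (h.natDegree_le t)
    (Polynomial.le_natDegree_of_ne_zero (by rw [h.coeff_eq]; exact h.ne_zero))

lemma leadingCoeff_eq (h : IsContinuousFamily φ d c) (t : T) : (φ t).leadingCoeff = c := by
  rw [Polynomial.leadingCoeff, h.natDegree_eq, h.coeff_eq]

lemma mem_complexRoots (h : IsContinuousFamily φ d c) {t : T} {z : ℂ} :
    z ∈ complexRoots (φ t) ↔ ((φ t).map Complex.ofRealHom).eval z = 0 := by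
  rw [complexRoots, Multiset.mem_toFinset, Polynomial.mem_roots, Polynomial.IsRoot.def]
  exact (Polynomial.map_ne_zero_iff Complex.ofRealHom.injective).2 (h.poly_ne_zero t)

lemma ofReal_mem_complexRoots (h : IsContinuousFamily φ d c) {t : T} {x : ℝ} :
    (x : ℂ) ∈ complexRoots (φ t) ↔ (φ t).eval x = 0 := by
  rw [h.mem_complexRoots]
  have := Polynomial.eval_map_apply (p := φ t) Complex.ofRealHom x
  simp only [Complex.ofRealHom_eq_coe] at this
  rw [this, Complex.ofReal_eq_zero]

lemma conj_mem_complexRoots (h : IsContinuousFamily φ d c) {t : T} {z : ℂ}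
    (hz : z ∈ complexRoots (φ t)) : starRingEnd ℂ z ∈ complexRoots (φ t) := by
  rw [h.mem_complexRoots] at hz ⊢
  have := congrArg (starRingEnd ℂ) hz
  rw [map_zero, ← Polynomial.eval_map_apply, Polynomial.map_map] at this
  convert this using 3
  ext x
  simp

lemma continuous_eval (h : IsContinuousFamily φ d c) {θ : T → ℝ} (hθ : Continuous θ) :
    Continuous fun t => (φ t).eval (θ t) := by
  have : (fun t => (φ t).eval (θ t)) =
      fun t => ∑ i ∈ Finset.range (d + 1), (φ t).coeff i * θ t ^ i := by
    ext t
    exact Polynomial.eval_eq_sum_range' (Nat.lt_succ_of_le (h.natDegree_le t)) _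
  rw [this]
  exact continuous_finsetSum _ fun i _ => (h.continuous_coeff i).mul (hθ.pow i)

lemma continuous_complex_eval (h : IsContinuousFamily φ d c) (z : ℂ) :
    Continuous fun t => ((φ t).map Complex.ofRealHom).eval z := by
  have : (fun t => ((φ t).map Complex.ofRealHom).eval z) =
      fun t => ∑ i ∈ Finset.range (d + 1), ((φ t).coeff i : ℂ) * z ^ i := by
    ext t
    rw [Polynomial.eval_eq_sum_range' (n := d + 1)]
    · simp
    · exact Nat.lt_succ_of_le ((Polynomial.natDegree_map_le).trans (h.natDegree_le t))
  rw [this]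
  exact continuous_finsetSum _ fun i _ =>
    (Complex.continuous_ofReal.comp (h.continuous_coeff i)).mul continuous_const

/-- Every root of a member of the family persists in nearby members. -/
lemma eventually_exists_root_near (h : IsContinuousFamily φ d c) {s : T} {z : ℂ}
    (hz : z ∈ complexRoots (φ s)) {ε : ℝ} (hε : 0 < ε) :
    ∀ᶠ t in 𝓝 s, ∃ ζ ∈ complexRoots (φ t), ‖ζ - z‖ < ε := by
  have hcont := (h.continuous_complex_eval z).norm.tendsto s
  rw [h.mem_complexRoots.1 hz, norm_zero] at hcont
  have hpos : 0 < |c| * ε ^ d := mul_pos (abs_pos.2 h.ne_zero) (pow_pos hε d)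
  filter_upwards [hcont.eventually_lt_const hpos] with t ht
  by_contra! hfar
  have hsp : ((φ t).map Complex.ofRealHom).Splits := IsAlgClosed.splits _
  have hcard : ((φ t).map Complex.ofRealHom).roots.card = d := by
    rw [← hsp.natDegree_eq_card_roots,
      Polynomial.natDegree_map_eq_of_injective Complex.ofRealHom.injective, h.natDegree_eq]
  rw [hsp.eval_eq_prod_roots, norm_mul, Polynomial.leadingCoeff_map, h.leadingCoeff_eq,
    Complex.ofRealHom_eq_coe, Complex.norm_real, Real.norm_eq_abs] at ht
  refine absurd ht (not_lt.2 (mul_le_mul_of_nonneg_left ?_ (abs_nonneg c)))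
  have key : ∀ m : Multiset ℂ, (∀ ζ ∈ m, ε ≤ ‖ζ - z‖) →
      ε ^ m.card ≤ ‖(m.map fun a => z - a).prod‖ := by
    intro m
    induction m using Multiset.induction_on with
    | empty => simp
    | cons a m ih =>
      intro hm
      rw [Multiset.card_cons, Multiset.map_cons, Multiset.prod_cons, norm_mul, pow_succ']
      refine mul_le_mul ?_ (ih fun ζ hζ => hm ζ (Multiset.mem_cons_of_mem hζ))
        (pow_nonneg hε.le _) (norm_nonneg _)
      rw [norm_sub_rev]
      exact hm a (Multiset.mem_cons_self a m)
  have := key _ fun ζ hζ => hfar ζ (Multiset.mem_toFinset.2 hζ)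
  rwa [hcard] at this

/-- If the number of distinct complex roots is constant, then for all small `ε` the roots of nearby
members are matched with the roots of a given member by being `ε`-close. -/
lemma eventually_matching (h : IsContinuousFamily p d c)
    (hcard : ∀ t t', (complexRoots (p t)).card = (complexRoots (p t')).card) (s : T) :
    ∃ δ > 0, (∀ z ∈ complexRoots (p s), ∀ z' ∈ complexRoots (p s), z ≠ z' → 2 * δ ≤ ‖z - z'‖) ∧
      ∀ ε, 0 < ε → ε ≤ δ → ∀ᶠ t in 𝓝 s,
        (∀ z ∈ complexRoots (p s), ∃ ζ ∈ complexRoots (p t), ‖ζ - z‖ < ε) ∧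
        (∀ ζ ∈ complexRoots (p t), ∃ z ∈ complexRoots (p s), ‖ζ - z‖ < ε) ∧
        (∀ z ∈ complexRoots (p s), ∀ ζ ∈ complexRoots (p t), ∀ ζ' ∈ complexRoots (p t),
          ‖ζ - z‖ < ε → ‖ζ' - z‖ < ε → ζ = ζ') := by
  obtain ⟨δ, hδ, hsep⟩ : ∃ δ > 0, ∀ z ∈ complexRoots (p s), ∀ z' ∈ complexRoots (p s), z ≠ z' →
      2 * δ ≤ ‖z - z'‖ := by
    rcases ((complexRoots (p s)).offDiag.image fun x => ‖x.1 - x.2‖ / 2).eq_empty_or_nonempty.symm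
      with hne | he
    · refine ⟨Finset.min' _ hne, ?_, fun z hz z' hz' hzz => ?_⟩
      rotate_left
      · have := Finset.min'_le _ _ (Finset.mem_image_of_mem (fun x : ℂ × ℂ => ‖x.1 - x.2‖ / 2)
          (Finset.mem_offDiag.2 ⟨hz, hz', hzz⟩ : (z, z') ∈ _))
        linarith
      · have := Finset.min'_mem _ hne
        rw [Finset.mem_image] at this
        obtain ⟨x, hx, hx'⟩ := this
        rw [gt_iff_lt, ← hx']
        have := norm_pos_iff.2 (sub_ne_zero.2 (Finset.mem_offDiag.1 hx).2.2)
        positivity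
    · refine ⟨1, one_pos, fun z hz z' hz' hzz => ?_⟩
      rw [Finset.image_eq_empty] at he
      exact absurd (Finset.mem_offDiag.2 ⟨hz, hz', hzz⟩ : (z, z') ∈ _) (by simp [he])
  refine ⟨δ, hδ, hsep, fun ε hε hεδ => ?_⟩
  have hev : ∀ᶠ t in 𝓝 s, ∀ z ∈ complexRoots (p s), ∃ ζ ∈ complexRoots (p t), ‖ζ - z‖ < ε :=
    (Filter.eventually_all_finset _).2 fun z hz => h.eventually_exists_root_near hz hε
  filter_upwards [hev] with t ht
  choose! g hg hgd using ht
  have hinj : Set.InjOn g (complexRoots (p s)) := by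
    intro z hz z' hz' hgz
    by_contra hzz
    have h1 := hsep z hz z' hz' hzz
    have h2 := hgd z hz
    have h3 := hgd z' hz'
    rw [hgz, norm_sub_rev] at h2
    have := norm_add_le (z - g z') (g z' - z')
    rw [sub_add_sub_cancel] at this
    linarith
  have himg : (complexRoots (p s)).image g = complexRoots (p t) := by
    refine Finset.eq_of_subset_of_card_le (Finset.image_subset_iff.2 hg) ?_
    rw [Finset.card_image_of_injOn hinj, hcard s t]
  have hsurj : ∀ ζ ∈ complexRoots (p t), ∃ z ∈ complexRoots (p s), g z = ζ := by
    intro ζ hζ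
    rwa [← himg, Finset.mem_image] at hζ
  have huniq : ∀ z ∈ complexRoots (p s), ∀ ζ ∈ complexRoots (p t), ‖ζ - z‖ < ε → ζ = g z := by
    intro z hz ζ hζ hd
    obtain ⟨z', hz', rfl⟩ := hsurj ζ hζ
    by_contra hne
    have h1 := hsep z hz z' hz' fun hzz => hne (by rw [hzz])
    have h2 := hgd z' hz'
    have := norm_add_le (z - g z') (g z' - z')
    rw [sub_add_sub_cancel] at this
    rw [norm_sub_rev] at hd
    linarith
  refine ⟨fun z hz => ⟨g z, hg z hz, hgd z hz⟩, fun ζ hζ => ?_, fun z hz ζ hζ ζ' hζ' hd hd' => ?_⟩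
  · obtain ⟨z, hz, rfl⟩ := hsurj ζ hζ
    exact ⟨z, hz, hgd z hz⟩
  · rw [huniq z hz ζ hζ hd, huniq z hz ζ' hζ' hd']


lemma mem_roots_toFinset (h : IsContinuousFamily φ d c) {t : T} {x : ℝ} :
    x ∈ (φ t).roots.toFinset ↔ (φ t).eval x = 0 := by
  rw [Multiset.mem_toFinset, Polynomial.mem_roots (h.poly_ne_zero t), Polynomial.IsRoot.def]

/-- The real version of `eventually_matching`. -/
lemma eventually_real_matching (h : IsContinuousFamily p d c)
    (hcard : ∀ t t', (complexRoots (p t)).card = (complexRoots (p t')).card) (s : T) :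
    ∃ δ > 0, (∀ x, (p s).eval x = 0 → ∀ x', (p s).eval x' = 0 → x ≠ x' → 2 * δ ≤ |x - x'|) ∧
      ∀ ε, 0 < ε → ε ≤ δ → ∀ᶠ t in 𝓝 s,
        (∀ x, (p s).eval x = 0 → ∃ ξ, (p t).eval ξ = 0 ∧ |ξ - x| < ε) ∧
        (∀ ξ, (p t).eval ξ = 0 → ∃ x, (p s).eval x = 0 ∧ |ξ - x| < ε) ∧
        (∀ x, (p s).eval x = 0 → ∀ ξ, (p t).eval ξ = 0 → ∀ ζ ∈ complexRoots (p t),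
          |ξ - x| < ε → ‖ζ - x‖ < ε → ζ = ξ) := by
  have hnorm : ∀ a b : ℝ, ‖(a : ℂ) - b‖ = |a - b| := fun a b => by
    rw [← Complex.ofReal_sub, Complex.norm_real, Real.norm_eq_abs]
  obtain ⟨δ, hδ, hsep, hev⟩ := h.eventually_matching hcard s
  refine ⟨δ, hδ, fun x hx x' hx' hne => ?_, fun ε hε hεδ => ?_⟩
  · rw [← hnorm]
    exact hsep _ (h.ofReal_mem_complexRoots.2 hx) _ (h.ofReal_mem_complexRoots.2 hx')
      (fun hh => hne (Complex.ofReal_injective hh))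
  filter_upwards [hev ε hε hεδ] with t ⟨h1, h2, h3⟩
  refine ⟨fun x hx => ?_, fun ξ hξ => ?_, fun x hx ξ hξ ζ hζ hd hd' => ?_⟩
  · have hx' := h.ofReal_mem_complexRoots.2 hx
    obtain ⟨ζ, hζ, hd⟩ := h1 _ hx'
    have hconj : ‖starRingEnd ℂ ζ - x‖ < ε := by
      have : starRingEnd ℂ ζ - x = starRingEnd ℂ (ζ - x) := by simp
      rwa [this, Complex.norm_conj]
    have heq := h3 _ hx' _ (h.conj_mem_complexRoots hζ) _ hζ hconj hd
    obtain ⟨r, rfl⟩ := Complex.conj_eq_iff_real.1 heq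
    exact ⟨r, h.ofReal_mem_complexRoots.1 hζ, by rwa [hnorm] at hd⟩
  · obtain ⟨z, hz, hd⟩ := h2 _ (h.ofReal_mem_complexRoots.2 hξ)
    have heq : starRingEnd ℂ z = z := by
      by_contra hne
      have h4 := hsep _ (h.conj_mem_complexRoots hz) _ hz hne
      have h5 : ‖starRingEnd ℂ z - ξ‖ < ε := by
        have : starRingEnd ℂ z - ξ = starRingEnd ℂ (z - ξ) := by simp
        rwa [this, Complex.norm_conj, norm_sub_rev]
      have := norm_add_le (starRingEnd ℂ z - ξ) (ξ - z)
      rw [sub_add_sub_cancel] at this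
      linarith
    obtain ⟨r, rfl⟩ := Complex.conj_eq_iff_real.1 heq
    exact ⟨r, h.ofReal_mem_complexRoots.1 hz, by rwa [hnorm] at hd⟩
  · exact h3 _ (h.ofReal_mem_complexRoots.2 hx) _ hζ _ (h.ofReal_mem_complexRoots.2 hξ) hd'
      (by rwa [hnorm])

lemma card_real_roots_eq [PreconnectedSpace T] (h : IsContinuousFamily p d c)
    (hcard : ∀ t t', (complexRoots (p t)).card = (complexRoots (p t')).card) (t t' : T) :
    (p t).roots.toFinset.card = (p t').roots.toFinset.card := by
  have hloc : IsLocallyConstant fun t => (p t).roots.toFinset.card := by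
    rw [IsLocallyConstant.iff_eventually_eq]
    intro s
    obtain ⟨δ, hδ, hsep, hev⟩ := h.eventually_real_matching hcard s
    filter_upwards [hev δ hδ le_rfl] with t ⟨h1, h2, h3⟩
    choose! g hg hgd using h1
    choose! k hk hkd using h2
    refine le_antisymm (Finset.card_le_card_of_injOn k (fun ξ hξ => ?_) ?_)
      (Finset.card_le_card_of_injOn g (fun x hx => ?_) ?_)
    · exact h.mem_roots_toFinset.2 (hk ξ (h.mem_roots_toFinset.1 hξ))
    · intro ξ hξ ξ' hξ' hkk
      have hξ := h.mem_roots_toFinset.1 hξ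
      have hξ' := h.mem_roots_toFinset.1 hξ'
      have h4 := hkd ξ' hξ'
      rw [← hkk] at h4
      have := h3 _ (hk ξ hξ) ξ' hξ' _ (h.ofReal_mem_complexRoots.2 hξ) h4
        (by rw [← Complex.ofReal_sub, Complex.norm_real]; exact hkd ξ hξ)
      exact Complex.ofReal_injective this
    · exact h.mem_roots_toFinset.2 (hg x (h.mem_roots_toFinset.1 hx))
    · intro x hx x' hx' hgg
      by_contra hne
      have hx := h.mem_roots_toFinset.1 hx
      have hx' := h.mem_roots_toFinset.1 hx'
      have h4 := hsep x hx x' hx' hne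
      have h5 := hgd x hx
      have h6 := hgd x' hx'
      rw [hgg] at h5
      rw [abs_lt] at h5 h6
      have : |x - x'| < 2 * δ := abs_lt.2 ⟨by linarith, by linarith⟩
      linarith
  exact hloc.apply_eq_of_isPreconnected isPreconnected_univ (mem_univ t) (mem_univ _)

/-- A family with constantly many distinct complex roots has continuous real root functions. -/
lemma exists_root_functions [PreconnectedSpace T] [Nonempty T] (h : IsContinuousFamily p d c)
    (hcard : ∀ t t', (complexRoots (p t)).card = (complexRoots (p t')).card) :
    ∃ (r : ℕ) (θ : Fin r → T → ℝ), (∀ i, Continuous (θ i)) ∧ (∀ t, StrictMono fun i => θ i t) ∧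
      ∀ t x, (p t).eval x = 0 ↔ ∃ i, θ i t = x := by
  obtain ⟨t₀⟩ := ‹Nonempty T›
  have hr : ∀ t, (p t).roots.toFinset.card = (p t₀).roots.toFinset.card := fun t =>
    h.card_real_roots_eq hcard t t₀
  have hroot : ∀ t i, (p t).eval ((p t).roots.toFinset.orderEmbOfFin (hr t) i) = 0 := fun t i =>
    h.mem_roots_toFinset.1 (Finset.orderEmbOfFin_mem _ (hr t) i)
  refine ⟨_, fun i t => (p t).roots.toFinset.orderEmbOfFin (hr t) i, fun i => ?_, fun t =>
    ((p t).roots.toFinset.orderEmbOfFin (hr t)).strictMono, fun t x => ?_⟩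
  · rw [continuous_iff_continuousAt]
    intro s
    obtain ⟨δ, hδ, hsep, hev⟩ := h.eventually_real_matching hcard s
    rw [Metric.continuousAt_iff']
    intro ε hε
    filter_upwards [hev (min ε δ) (lt_min hε hδ) (min_le_right _ _)] with t ⟨h1, h2, h3⟩
    choose u hu hud using fun i => h1 _ (hroot s i)
    have hmono : StrictMono u := by
      intro i j hij
      have hlt := ((p s).roots.toFinset.orderEmbOfFin (hr s)).strictMono hij
      have h4 := hsep _ (hroot s j) _ (hroot s i) hlt.ne'
      rw [abs_of_pos (sub_pos.2 hlt)] at h4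
      have h5 := abs_lt.1 ((hud i).trans_le (min_le_right _ _))
      have h6 := abs_lt.1 ((hud j).trans_le (min_le_right _ _))
      linarith
    have hu_eq := Finset.orderEmbOfFin_unique (hr t)
      (fun i => h.mem_roots_toFinset.2 (hu i)) hmono
    rw [Real.dist_eq, ← hu_eq]
    exact (hud i).trans_le (min_le_left _ _)
  · rw [← h.mem_roots_toFinset, ← Finset.mem_coe, ← Finset.range_orderEmbOfFin _ (hr t)]
    rfl

/-- Along a continuous choice of roots, the vanishing of a factor is constant. -/
lemma factor_eval_eq_zero [PreconnectedSpace T] (h : IsContinuousFamily p d c)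
    (hcard : ∀ t t', (complexRoots (p t)).card = (complexRoots (p t')).card)
    {θ : T → ℝ} (hθ : Continuous θ) (hroot : ∀ t, (p t).eval (θ t) = 0)
    (hφ : IsContinuousFamily φ e b) (hdvd : ∀ t, φ t ∣ p t) {t t' : T}
    (ht : (φ t).eval (θ t) = 0) : (φ t').eval (θ t') = 0 := by
  have hclosed : IsClosed {t | (φ t).eval (θ t) = 0} :=
    isClosed_eq (hφ.continuous_eval hθ) continuous_const
  have hopen : IsOpen {t | (φ t).eval (θ t) = 0} := by
    rw [isOpen_iff_eventually]
    intro s hs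
    obtain ⟨δ, hδ, -, hev⟩ := h.eventually_real_matching hcard s
    have hnear : ∀ᶠ t in 𝓝 s, |θ t - θ s| < δ := by
      have := Metric.continuousAt_iff'.1 (hθ.continuousAt (x := s)) δ hδ
      simpa only [Real.dist_eq] using this
    filter_upwards [hev δ hδ le_rfl, hnear,
      hφ.eventually_exists_root_near (hφ.ofReal_mem_complexRoots.2 hs) hδ]
      with t ⟨_, _, h3⟩ hclose ⟨ζ, hζ, hd⟩
    have hζp : ζ ∈ complexRoots (p t) := by
      rw [h.mem_complexRoots]
      rw [hφ.mem_complexRoots] at hζ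
      exact Polynomial.eval_eq_zero_of_dvd_of_eval_eq_zero
        (Polynomial.map_dvd Complex.ofRealHom (hdvd t)) hζ
    rw [h3 _ (hroot s) _ (hroot t) ζ hζp hclose hd] at hζ
    exact hφ.ofReal_mem_complexRoots.1 hζ
  have huniv := IsClopen.eq_univ ⟨hclosed, hopen⟩ ⟨t, ht⟩
  exact huniv.ge (mem_univ _)

/-- Real roots are bounded in terms of the coefficients. -/
lemma exists_root_bound (h : IsContinuousFamily p d c)
    (hM : ∃ M, ∀ t i, |(p t).coeff i| ≤ M) :
    ∃ R, ∀ t x, (p t).eval x = 0 → |x| ≤ R := by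
  obtain ⟨M, hM⟩ := hM
  refine ⟨1 + (d * M) / |c|, fun t x hx => ?_⟩
  have hM0 : 0 ≤ M := (abs_nonneg _).trans (hM t 0)
  have hc : 0 < |c| := abs_pos.2 h.ne_zero
  by_contra! hlt
  have hx1 : 1 ≤ |x| := by
    have : 0 ≤ (d * M) / |c| := by positivity
    linarith
  rw [Polynomial.eval_eq_sum_range' (Nat.lt_succ_of_le (h.natDegree_le t)),
    Finset.sum_range_succ, h.coeff_eq] at hx
  rcases Nat.eq_zero_or_pos d with rfl | hd
  · simp [h.ne_zero] at hx
  have h1 : |c| * |x| ^ d ≤ d * M * |x| ^ (d - 1) := by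
    rw [← abs_pow, ← abs_mul, ← abs_neg, ← eq_neg_of_add_eq_zero_left hx]
    refine (Finset.abs_sum_le_sum_abs _ _).trans ?_
    calc ∑ i ∈ Finset.range d, |(p t).coeff i * x ^ i|
        ≤ ∑ i ∈ Finset.range d, M * |x| ^ (d - 1) := by
          refine Finset.sum_le_sum fun i hi => ?_
          rw [abs_mul, abs_pow]
          have : i ≤ d - 1 := Nat.le_sub_one_of_lt (Finset.mem_range.1 hi)
          exact mul_le_mul (hM t i) (pow_le_pow_right₀ hx1 this) (by positivity) hM0
      _ = d * M * |x| ^ (d - 1) := by simp [mul_assoc]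
  have h2 : |x| ^ d = |x| * |x| ^ (d - 1) := by
    rw [← pow_succ', Nat.sub_add_cancel hd]
  rw [h2, ← mul_assoc] at h1
  have h3 : |c| * |x| ≤ d * M := le_of_mul_le_mul_right h1 (by positivity)
  have h4 : (d * M) / |c| < |x| := by linarith
  rw [div_lt_iff₀ hc] at h4
  linarith

/-- Through every point there is a continuous lift along which every factor of the family has
constant vanishing behaviour; the lift is bounded when the coefficients are. -/
lemma exists_lift [PreconnectedSpace T] (h : IsContinuousFamily p d c)
    (hcard : ∀ t t', (complexRoots (p t)).card = (complexRoots (p t')).card) (t₀ : T) (w : ℝ) :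
    ∃ θ : T → ℝ, Continuous θ ∧ θ t₀ = w ∧
      (∀ (φ : T → Polynomial ℝ) (e : ℕ) (b : ℝ), IsContinuousFamily φ e b → (∀ t, φ t ∣ p t) →
        ∀ t t', (φ t).eval (θ t) = 0 → (φ t').eval (θ t') = 0) ∧
      ((∃ M, ∀ t i, |(p t).coeff i| ≤ M) → ∃ R, ∀ t, |θ t| ≤ R) := by
  have : Nonempty T := ⟨t₀⟩
  obtain ⟨r, θ, hcont, hmono, hroots⟩ := h.exists_root_functions hcard
  have hbound : (∃ M, ∀ t i, |(p t).coeff i| ≤ M) → ∃ R, ∀ t i, |θ i t| ≤ R := fun hM => by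
    obtain ⟨R, hR⟩ := h.exists_root_bound hM
    exact ⟨R, fun t i => hR t _ ((hroots t _).2 ⟨i, rfl⟩)⟩
  by_cases hw : (p t₀).eval w = 0
  · obtain ⟨i, rfl⟩ := (hroots t₀ w).1 hw
    refine ⟨θ i, hcont i, rfl, fun φ e b hφ hdvd t t' ht => ?_, fun hM => ?_⟩
    · exact h.factor_eval_eq_zero hcard (hcont i) (fun t => (hroots t _).2 ⟨i, rfl⟩) hφ hdvd ht
    · obtain ⟨R, hR⟩ := hbound hM
      exact ⟨R, fun t => hR t i⟩
  suffices hs : ∃ η : T → ℝ, Continuous η ∧ η t₀ = w ∧ (∀ t i, θ i t ≠ η t) ∧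
      ((∃ R, ∀ t i, |θ i t| ≤ R) → ∃ R, ∀ t, |η t| ≤ R) by
    obtain ⟨η, hη, hη0, hne, hb⟩ := hs
    refine ⟨η, hη, hη0, fun φ e b hφ hdvd t t' ht => ?_, fun hM => hb (hbound hM)⟩
    obtain ⟨i, hi⟩ := (hroots t _).1
      (Polynomial.eval_eq_zero_of_dvd_of_eval_eq_zero (hdvd t) ht)
    exact absurd hi (hne t i)
  have hwne : ∀ i, θ i t₀ ≠ w := fun i hi => hw ((hroots t₀ w).2 ⟨i, hi⟩)
  by_cases hlow : ∃ i, θ i t₀ < w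
  · obtain ⟨i, hi, hmax⟩ : ∃ i, θ i t₀ < w ∧ ∀ j, i < j → w < θ j t₀ := by
      obtain ⟨i, hi⟩ := (Finset.univ.filter fun i => θ i t₀ < w).exists_maximal
        (by obtain ⟨i, hi⟩ := hlow; exact ⟨i, by simpa using hi⟩)
      refine ⟨i, by simpa using hi.1, fun j hij => ?_⟩
      by_contra hj
      have : θ j t₀ < w := lt_of_le_of_ne (not_lt.1 hj) (hwne j)
      exact absurd (hi.2 (by simpa using this) hij.le) (not_le.2 hij)
    by_cases htop : (i : ℕ) + 1 < r
    · set j : Fin r := ⟨i + 1, htop⟩ with hj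
      have hij : i < j := Fin.lt_def.2 (Nat.lt_succ_self _)
      have hpos : 0 < θ j t₀ - θ i t₀ := sub_pos.2 (hmono t₀ hij)
      set a := (w - θ i t₀) / (θ j t₀ - θ i t₀) with ha
      have ha0 : 0 < a := div_pos (sub_pos.2 hi) hpos
      have ha1 : a < 1 := (div_lt_one hpos).2 (by linarith [hmax j hij])
      refine ⟨fun t => θ i t + a * (θ j t - θ i t), (hcont i).add
        (continuous_const.mul ((hcont j).sub (hcont i))), ?_, fun t l hl => ?_, ?_⟩
      · have : a * (θ j t₀ - θ i t₀) = w - θ i t₀ := div_mul_cancel₀ _ hpos.ne'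
        simp only [this]
        ring
      · have hd : 0 < θ j t - θ i t := sub_pos.2 (hmono t hij)
        rcases le_or_gt l i with hli | hil
        · have := (hmono t).monotone hli
          nlinarith
        · have hjl : j ≤ l := Fin.le_def.2 (Nat.succ_le_of_lt (Fin.lt_def.1 hil))
          have := (hmono t).monotone hjl
          nlinarith
      · rintro ⟨R, hR⟩
        refine ⟨R, fun t => ?_⟩
        have h1 := abs_le.1 (hR t i)
        have h2 := abs_le.1 (hR t j)
        exact abs_le.2 ⟨by nlinarith, by nlinarith⟩
    · refine ⟨fun t => θ i t + (w - θ i t₀), (hcont i).add continuous_const, by ring,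
        fun t l hl => ?_, ?_⟩
      · have hli : l ≤ i := Fin.le_def.2 (by have := l.2; omega)
        have := (hmono t).monotone hli
        linarith
      · rintro ⟨R, hR⟩
        exact ⟨R + |w - θ i t₀|, fun t => (abs_add_le _ _).trans (by linarith [hR t i])⟩
  · push Not at hlow
    rcases Nat.eq_zero_or_pos r with rfl | hr
    · exact ⟨fun _ => w, continuous_const, rfl, fun t i => i.elim0, fun _ => ⟨|w|, fun _ => le_rfl⟩⟩
    · have hlt : w < θ ⟨0, hr⟩ t₀ := lt_of_le_of_ne (hlow _) (hwne _).symm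
      refine ⟨fun t => θ ⟨0, hr⟩ t + (w - θ ⟨0, hr⟩ t₀), (hcont _).add continuous_const, by ring,
        fun t l hl => ?_, ?_⟩
      · have := (hmono t).monotone (Fin.le_def.2 (Nat.zero_le l) : (⟨0, hr⟩ : Fin r) ≤ l)
        linarith
      · rintro ⟨R, hR⟩
        exact ⟨R + |w - θ ⟨0, hr⟩ t₀|, fun t => (abs_add_le _ _).trans (by linarith [hR t ⟨0, hr⟩])⟩

end IsContinuousFamily

/-- The sum over all `r`-element sets of indices of the discriminants of the corresponding
variables. -/
noncomputable def subdiscriminant (d r : ℕ) : MvPolynomial (Fin d) ℤ :=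
  ∑ S ∈ Finset.powersetCard r Finset.univ, ∏ x ∈ S.offDiag, (X x.1 - X x.2)

lemma subdiscriminant_isSymmetric (d r : ℕ) : (subdiscriminant d r).IsSymmetric := by
  intro e
  simp only [subdiscriminant, map_sum, map_prod, map_sub, rename_X]
  refine Finset.sum_bij (fun S _ => S.map e.toEmbedding) (fun S hS => ?_) (fun S _ S' _ hSS => ?_)
    (fun S hS => ?_) (fun S _ => ?_)
  · simpa [Finset.mem_powersetCard] using hS
  · exact Finset.map_injective _ hSS
  · refine ⟨S.map e.symm.toEmbedding, by simpa [Finset.mem_powersetCard] using hS, ?_⟩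
    ext x
    simp
  · refine Finset.prod_bij (fun x _ => (e x.1, e x.2)) (fun x hx => ?_) (fun x _ y _ hxy => ?_)
      (fun x hx => ?_) (fun x _ => rfl)
    · simpa [Finset.mem_offDiag] using hx
    · simpa [Prod.ext_iff] using hxy
    · refine ⟨(e.symm x.1, e.symm x.2), ?_, by simp⟩
      simp only [Finset.mem_offDiag, Finset.mem_map_equiv] at hx ⊢
      simpa using hx

lemma aeval_subdiscriminant {d : ℕ} (r : ℕ) (θ : Fin d → ℂ) :
    aeval θ (subdiscriminant d r) =
      ∑ S ∈ Finset.powersetCard r Finset.univ, ∏ x ∈ S.offDiag, (θ x.1 - θ x.2) := by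
  simp [subdiscriminant]

lemma aeval_subdiscriminant_eq_zero {d r : ℕ} {θ : Fin d → ℂ}
    (hr : (Finset.univ.image θ).card < r) : aeval θ (subdiscriminant d r) = 0 := by
  rw [aeval_subdiscriminant]
  refine Finset.sum_eq_zero fun S hS => ?_
  obtain ⟨x, hx, y, hy, hne, heq⟩ := Finset.exists_ne_map_eq_of_card_lt_of_maps_to
    (hr.trans_eq (Finset.mem_powersetCard.1 hS).2.symm)
    (fun x _ => Finset.mem_image_of_mem θ (Finset.mem_univ x))
  exact Finset.prod_eq_zero (Finset.mem_offDiag.2 ⟨hx, hy, hne⟩ : (x, y) ∈ _) (by simp [heq])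

lemma aeval_subdiscriminant_ne_zero {d : ℕ} (θ : Fin d → ℂ) :
    aeval θ (subdiscriminant d (Finset.univ.image θ).card) ≠ 0 := by
  set E := Finset.univ.image θ with hE
  set Δ : ℂ := ∏ z ∈ E.offDiag, (z.1 - z.2) with hΔ
  have hΔ0 : Δ ≠ 0 := Finset.prod_ne_zero_iff.2 fun z hz =>
    sub_ne_zero.2 (Finset.mem_offDiag.1 hz).2.2
  have hterm : ∀ S ∈ Finset.powersetCard E.card (Finset.univ : Finset (Fin d)),
      ∏ x ∈ S.offDiag, (θ x.1 - θ x.2) = if Set.InjOn θ S then Δ else 0 := by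
    intro S hS
    split_ifs with hinj
    · have himg : S.image θ = E := Finset.eq_of_subset_of_card_le
        (Finset.image_subset_image (Finset.subset_univ S))
        (by rw [Finset.card_image_of_injOn hinj, (Finset.mem_powersetCard.1 hS).2])
      refine Finset.prod_bij (fun x _ => (θ x.1, θ x.2)) (fun x hx => ?_) (fun x hx y hy hxy => ?_)
        (fun z hz => ?_) (fun x _ => rfl)
      · obtain ⟨h1, h2, h3⟩ := Finset.mem_offDiag.1 hx
        rw [← himg]
        exact Finset.mem_offDiag.2 ⟨Finset.mem_image_of_mem θ h1, Finset.mem_image_of_mem θ h2,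
          fun h => h3 (hinj h1 h2 h)⟩
      · obtain ⟨h1, h2, -⟩ := Finset.mem_offDiag.1 hx
        obtain ⟨h3, h4, -⟩ := Finset.mem_offDiag.1 hy
        rw [Prod.ext_iff] at hxy
        exact Prod.ext (hinj h1 h3 hxy.1) (hinj h2 h4 hxy.2)
      · rw [← himg] at hz
        obtain ⟨h1, h2, h3⟩ := Finset.mem_offDiag.1 hz
        obtain ⟨x, hx, hx'⟩ := Finset.mem_image.1 h1
        obtain ⟨y, hy, hy'⟩ := Finset.mem_image.1 h2
        refine ⟨(x, y), Finset.mem_offDiag.2 ⟨hx, hy, fun h => h3 ?_⟩, by simp [hx', hy']⟩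
        rw [← hx', ← hy', show x = y from h]
    · simp only [Set.InjOn, not_forall] at hinj
      obtain ⟨x, hx, y, hy, heq, hne⟩ := hinj
      exact Finset.prod_eq_zero (Finset.mem_offDiag.2 ⟨hx, hy, hne⟩ : (x, y) ∈ _) (by simp [heq])
  rw [aeval_subdiscriminant, Finset.sum_congr rfl hterm, ← Finset.sum_filter, Finset.sum_const,
    nsmul_eq_mul]
  refine mul_ne_zero (Nat.cast_ne_zero.2 (Finset.card_ne_zero.2 ?_)) hΔ0
  obtain ⟨S, -, hinj, himg⟩ := Finset.exists_subset_injOn_image_eq_of_surjOn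
    (Finset.univ : Finset (Fin d)) E (f := θ) (by
      intro z hz
      obtain ⟨x, hx, hx'⟩ := Finset.mem_image.1 (Finset.mem_coe.1 hz)
      exact ⟨x, by simp, hx'⟩)
  refine ⟨S, Finset.mem_filter.2 ⟨Finset.mem_powersetCard.2 ⟨Finset.subset_univ _, ?_⟩, hinj⟩⟩
  rw [← himg, Finset.card_image_of_injOn hinj]

lemma card_image_eq_of_subdiscriminant {d : ℕ} {θ θ' : Fin d → ℂ}
    (h : ∀ r ≤ d, aeval θ (subdiscriminant d r) = 0 ↔ aeval θ' (subdiscriminant d r) = 0) :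
    (Finset.univ.image θ).card = (Finset.univ.image θ').card := by
  have hle : ∀ η : Fin d → ℂ, (Finset.univ.image η).card ≤ d := fun η =>
    Finset.card_image_le.trans (by simp)
  refine le_antisymm (not_lt.1 fun hlt => ?_) (not_lt.1 fun hlt => ?_)
  · exact aeval_subdiscriminant_ne_zero θ ((h _ (hle θ)).2 (aeval_subdiscriminant_eq_zero hlt))
  · exact aeval_subdiscriminant_ne_zero θ' ((h _ (hle θ')).1 (aeval_subdiscriminant_eq_zero hlt))

lemma exists_subdiscriminant_in_esymm (d r : ℕ) : ∃ Q : MvPolynomial (Fin d) ℤ,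
    aeval (fun i : Fin d => esymm (Fin d) ℤ (i + 1)) Q = subdiscriminant d r := by
  obtain ⟨Q, hQ⟩ := esymmAlgHom_surjective (σ := Fin d) (n := d) ℤ (by simp)
    ⟨subdiscriminant d r, subdiscriminant_isSymmetric d r⟩
  exact ⟨Q, by rw [← esymmAlgHom_apply, hQ]⟩

/-- The `r`-th subdiscriminant of a polynomial of degree `d` with leading coefficient `c`, expressed
through the coefficients (of the monic polynomial whose roots are multiplied by `c`). -/
noncomputable def coeffSubdiscriminant {R : Type*} [CommRing R] (d r : ℕ) (p : Polynomial R)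
    (c : R) : R :=
  aeval (fun i : Fin d => (-1) ^ (i + 1 : ℕ) * p.coeff (d - (i + 1)) * c ^ (i : ℕ))
    (exists_subdiscriminant_in_esymm d r).choose

lemma map_coeffSubdiscriminant {R S : Type*} [CommRing R] [CommRing S] (f : R →+* S) (d r : ℕ)
    (p : Polynomial R) (c : R) :
    f (coeffSubdiscriminant d r p c) = coeffSubdiscriminant d r (p.map f) (f c) := by
  unfold coeffSubdiscriminant
  generalize (exists_subdiscriminant_in_esymm d r).choose = Q
  rw [aeval_def, aeval_def, MvPolynomial.eval₂_comp_left]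
  congr 1
  · exact RingHom.ext_int _ _
  · ext i
    simp

lemma exists_roots_coeffSubdiscriminant {d : ℕ} {p : Polynomial ℂ} {c : ℂ} (hd : p.natDegree = d)
    (hc : p.leadingCoeff = c) : ∃ θ : Fin d → ℂ, Finset.univ.image θ = p.roots.toFinset ∧
      ∀ r, coeffSubdiscriminant d r p c = aeval (fun i => c * θ i) (subdiscriminant d r) := by
  have hsp : p.Splits := IsAlgClosed.splits p
  have hcard : p.roots.toList.length = d := by
    rw [Multiset.length_toList, ← hsp.natDegree_eq_card_roots, hd]
  subst hcard
  have hmap : (Finset.univ : Finset (Fin p.roots.toList.length)).val.map p.roots.toList.get =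
      p.roots := by
    have h : (Finset.univ : Finset (Fin p.roots.toList.length)).val.map p.roots.toList.get =
        (p.roots.toList : Multiset ℂ) := by
      rw [Fin.univ_val_map, List.ofFn_get]
    rw [h, Multiset.coe_toList]
  refine ⟨p.roots.toList.get, ?_, fun r => ?_⟩
  · rw [Finset.image, hmap]
  · rw [← (exists_subdiscriminant_in_esymm _ r).choose_spec, coeffSubdiscriminant,
      ← AlgHom.comp_apply, comp_aeval]
    congr 2
    funext i
    have hi : (i : ℕ) + 1 ≤ p.roots.toList.length := i.2
    rw [Polynomial.coeff_eq_esymm_roots_of_splits hsp (by omega), hd, hc,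
      Nat.sub_sub_self hi]
    have hscale : aeval (fun j => c * p.roots.toList.get j)
        (esymm (Fin p.roots.toList.length) ℤ (i + 1)) =
        c ^ ((i : ℕ) + 1) * aeval p.roots.toList.get
          (esymm (Fin p.roots.toList.length) ℤ (i + 1)) := by
      simp only [esymm, map_sum, map_prod, aeval_X, Finset.mul_sum]
      refine Finset.sum_congr rfl fun S hS => ?_
      rw [Finset.prod_mul_distrib, Finset.prod_const, (Finset.mem_powersetCard.1 hS).2]
    rw [hscale, aeval_esymm_eq_multiset_esymm, hmap]
    have : ((-1 : ℂ) ^ ((i : ℕ) + 1)) * (-1) ^ ((i : ℕ) + 1) = 1 := by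
      rw [← mul_pow]; simp
    linear_combination (c ^ ((i : ℕ) + 1) * p.roots.esymm (i + 1)) * this

/-- The vanishing of the subdiscriminants determines the number of distinct complex roots. -/
lemma card_complexRoots_eq {d : ℕ} {p p' : Polynomial ℝ} {c : ℝ} (hc : c ≠ 0)
    (hd : p.natDegree = d) (hd' : p'.natDegree = d) (hl : p.leadingCoeff = c)
    (hl' : p'.leadingCoeff = c)
    (h : ∀ r ≤ d, coeffSubdiscriminant d r p c = 0 ↔ coeffSubdiscriminant d r p' c = 0) :
    (complexRoots p).card = (complexRoots p').card := by
  have hinj : Function.Injective Complex.ofRealHom := Complex.ofRealHom.injective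
  have key : ∀ q : Polynomial ℝ, q.natDegree = d → q.leadingCoeff = c → ∃ θ : Fin d → ℂ,
      (Finset.univ.image θ).card = (complexRoots q).card ∧
      ∀ r, aeval θ (subdiscriminant d r) = 0 ↔ coeffSubdiscriminant d r q c = 0 := by
    intro q hq hqc
    obtain ⟨θ, hθ, hsub⟩ := exists_roots_coeffSubdiscriminant (d := d) (c := (c : ℂ))
      (p := q.map Complex.ofRealHom)
      (by rw [Polynomial.natDegree_map_eq_of_injective hinj, hq])
      (by rw [Polynomial.leadingCoeff_map, hqc, Complex.ofRealHom_eq_coe])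
    refine ⟨fun i => c * θ i, ?_, fun r => ?_⟩
    · rw [complexRoots, ← hθ, ← Finset.card_image_of_injective (Finset.univ.image θ)
        (mul_right_injective₀ (Complex.ofReal_ne_zero.2 hc)), Finset.image_image]
      rfl
    · rw [← hsub, ← Complex.ofRealHom_eq_coe, ← map_coeffSubdiscriminant,
        map_eq_zero_iff _ hinj]
  obtain ⟨θ, hθ, hsub⟩ := key p hd hl
  obtain ⟨θ', hθ', hsub'⟩ := key p' hd' hl'
  rw [← hθ, ← hθ']
  exact card_image_eq_of_subdiscriminant fun r hr => by rw [hsub, hsub', h r hr]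

section LineRestriction

variable {ι R S : Type*} [CommRing R] [CommRing S]

/-- The restriction of a polynomial to the line through `y` with direction `v`. -/
noncomputable def lineRestriction (y v : ι → R) : MvPolynomial ι R →+* Polynomial R :=
  eval₂Hom Polynomial.C fun i => Polynomial.C (y i) + Polynomial.X * Polynomial.C (v i)

lemma eval_lineRestriction (y v : ι → R) (G : MvPolynomial ι R) (t : R) :
    (lineRestriction y v G).eval t = eval (fun i => y i + t * v i) G := by
  rw [lineRestriction, coe_eval₂Hom, ← Polynomial.coe_evalRingHom, MvPolynomial.eval₂_comp_left,
    ← eval₂_id]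
  congr 1
  · ext a
    simp
  · funext i
    simp
    exact mul_comm _ _

lemma map_lineRestriction (f : R →+* S) (y v : ι → R) (G : MvPolynomial ι R) :
    (lineRestriction y v G).map f =
      lineRestriction (fun i => f (y i)) (fun i => f (v i)) (map f G) := by
  rw [lineRestriction, lineRestriction, coe_eval₂Hom, coe_eval₂Hom, eval₂_map,
    ← Polynomial.coe_mapRingHom, MvPolynomial.eval₂_comp_left]
  congr 1
  · ext a : 1
    simp
  · funext i
    simp

lemma lineRestriction_eq_sum (y v : ι → R) (G : MvPolynomial ι R) :
    lineRestriction y v G = ∑ m ∈ G.support, Polynomial.C (coeff m G) *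
      ∏ i ∈ m.support, (Polynomial.C (y i) + Polynomial.X * Polynomial.C (v i)) ^ m i := by
  rw [lineRestriction, coe_eval₂Hom, eval₂_eq]

lemma natDegree_linear_le (a b : R) :
    (Polynomial.C a + Polynomial.X * Polynomial.C b).natDegree ≤ 1 := by
  compute_degree

lemma natDegree_lineMonomial_le (y v : ι → R) (m : ι →₀ ℕ) :
    (∏ i ∈ m.support,
      (Polynomial.C (y i) + Polynomial.X * Polynomial.C (v i)) ^ m i).natDegree ≤ m.degree := by
  refine (Polynomial.natDegree_prod_le _ _).trans (Finset.sum_le_sum fun i _ => ?_)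
  simpa using Polynomial.natDegree_pow_le_of_le (m i) (natDegree_linear_le (y i) (v i))

lemma coeff_lineMonomial (y v : ι → R) (m : ι →₀ ℕ) :
    (∏ i ∈ m.support,
      (Polynomial.C (y i) + Polynomial.X * Polynomial.C (v i)) ^ m i).coeff m.degree =
      ∏ i ∈ m.support, v i ^ m i := by
  have key : ∀ s : Finset ι, (∏ i ∈ s,
      (Polynomial.C (y i) + Polynomial.X * Polynomial.C (v i)) ^ m i).coeff (∑ i ∈ s, m i) =
      ∏ i ∈ s, v i ^ m i := by
    classical
    intro s
    have hpow : ∀ i, ((Polynomial.C (y i) + Polynomial.X * Polynomial.C (v i)) ^ m i).natDegree ≤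
        m i := fun i => by
      simpa using Polynomial.natDegree_pow_le_of_le (m i) (natDegree_linear_le (y i) (v i))
    induction s using Finset.induction_on with
    | empty => simp
    | insert i s hi ih =>
      rw [Finset.prod_insert hi, Finset.sum_insert hi, Finset.prod_insert hi,
        Polynomial.coeff_mul_add_eq_of_natDegree_le (hpow i)
          ((Polynomial.natDegree_prod_le _ _).trans (Finset.sum_le_sum fun j _ => hpow j)), ih]
      have := Polynomial.coeff_pow_of_natDegree_le (m := m i) (natDegree_linear_le (y i) (v i))
      rw [mul_one] at this
      rw [this]
      simp [Polynomial.coeff_C]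
  exact key m.support

lemma natDegree_lineRestriction_le (y v : ι → R) {G : MvPolynomial ι R} {N : ℕ}
    (hN : G.totalDegree ≤ N) : (lineRestriction y v G).natDegree ≤ N := by
  rw [lineRestriction_eq_sum]
  refine Polynomial.natDegree_sum_le_of_forall_le _ _ fun m hm => ?_
  exact (Polynomial.natDegree_C_mul_le _ _).trans ((natDegree_lineMonomial_le y v m).trans
    ((le_totalDegree hm).trans hN))

lemma coeff_lineRestriction (y v : ι → R) {G : MvPolynomial ι R} {N : ℕ}
    (hN : G.totalDegree ≤ N) :
    (lineRestriction y v G).coeff N = eval v (homogeneousComponent N G) := by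
  rw [lineRestriction_eq_sum, Polynomial.finsetSum_coeff, homogeneousComponent_apply, map_sum,
    Finset.sum_filter]
  refine Finset.sum_congr rfl fun m hm => ?_
  rw [Polynomial.coeff_C_mul]
  split_ifs with hd
  · rw [← hd, coeff_lineMonomial, eval_monomial]
    rfl
  · rw [Polynomial.coeff_eq_zero_of_natDegree_lt, mul_zero]
    exact (natDegree_lineMonomial_le y v m).trans_lt
      (lt_of_le_of_ne ((le_totalDegree hm).trans hN) hd)

lemma continuous_coeff_lineRestriction (v : ι → ℝ) (G : MvPolynomial ι ℝ) (N : ℕ) :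
    Continuous fun y => (lineRestriction y v G).coeff N := by
  have : (fun y => (lineRestriction y v G).coeff N) = fun y =>
      eval y ((lineRestriction X (fun i => C (v i)) (map C G)).coeff N) := by
    funext y
    rw [← Polynomial.coeff_map, map_lineRestriction, map_map]
    have : (eval y).comp C = RingHom.id ℝ := by ext a; simp
    simp [this, map_id]
  rw [this]
  exact MvPolynomial.continuous_eval _

end LineRestriction

section GenericProjection

variable {n : ℕ}

/-- The specialization of the matrix entries in a polynomial with generic coefficients. -/
noncomputable def specialize (v : Fin n × Fin n → ℝ) :
    MvPolynomial (Fin n) (MvPolynomial (Fin n × Fin n) ℝ) →+* MvPolynomial (Fin n) ℝ :=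
  map (eval v)

/-- The coefficient of the top power in the restriction of `G` to lines in the direction of the
`k`-th generic column. -/
noncomputable def topCoeff (k : Fin n)
    (G : MvPolynomial (Fin n) (MvPolynomial (Fin n × Fin n) ℝ)) : MvPolynomial (Fin n × Fin n) ℝ :=
  eval (fun i => X (i, k)) (homogeneousComponent G.totalDegree G)

/-- The subdiscriminants of `G` along lines in the direction of the `k`-th generic column. -/
noncomputable def projPoly (k : Fin n) (G : MvPolynomial (Fin n) (MvPolynomial (Fin n × Fin n) ℝ))
    (r : ℕ) : MvPolynomial (Fin n) (MvPolynomial (Fin n × Fin n) ℝ) :=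
  coeffSubdiscriminant G.totalDegree r
    (lineRestriction X (fun i => C (X (i, k))) (map C G)) (C (topCoeff k G))

/-- The coefficients of `G` only involve columns with index at least `j`. -/
def DependsOnColumns (j : ℕ) (G : MvPolynomial (Fin n) (MvPolynomial (Fin n × Fin n) ℝ)) : Prop :=
  ∀ v v' : Fin n × Fin n → ℝ, (∀ (i l : Fin n), j ≤ (l : ℕ) → v (i, l) = v' (i, l)) →
    specialize v G = specialize v' G

lemma homogeneousComponent_specialize (v : Fin n × Fin n → ℝ) (N : ℕ)
    (G : MvPolynomial (Fin n) (MvPolynomial (Fin n × Fin n) ℝ)) :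
    specialize v (homogeneousComponent N G) = homogeneousComponent N (specialize v G) := by
  ext m
  simp only [specialize, coeff_map, coeff_homogeneousComponent]
  split_ifs <;> simp

lemma totalDegree_specialize_le (v : Fin n × Fin n → ℝ)
    (G : MvPolynomial (Fin n) (MvPolynomial (Fin n × Fin n) ℝ)) :
    (specialize v G).totalDegree ≤ G.totalDegree :=
  Finset.sup_mono (support_map_subset _ _)

lemma eval_topCoeff (v : Fin n × Fin n → ℝ) (k : Fin n)
    (G : MvPolynomial (Fin n) (MvPolynomial (Fin n × Fin n) ℝ)) :
    eval v (topCoeff k G) =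
      eval (fun i => v (i, k)) (homogeneousComponent G.totalDegree (specialize v G)) := by
  rw [← homogeneousComponent_specialize, topCoeff, specialize, eval_map,
    ← eval₂_id (g := fun i => X (i, k)), MvPolynomial.eval₂_comp_left, RingHom.comp_id]
  congr 1
  funext i
  simp

lemma eval_projPoly (v : Fin n × Fin n → ℝ) (y : Fin n → ℝ) (k : Fin n)
    (G : MvPolynomial (Fin n) (MvPolynomial (Fin n × Fin n) ℝ)) (r : ℕ) :
    eval y (specialize v (projPoly k G r)) = coeffSubdiscriminant G.totalDegree r
      (lineRestriction y (fun i => v (i, k)) (specialize v G)) (eval v (topCoeff k G)) := by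
  rw [projPoly, ← RingHom.comp_apply, map_coeffSubdiscriminant, map_lineRestriction, map_map]
  have : ((eval y).comp (specialize v)).comp C = eval v := by
    ext a <;> simp [specialize]
  rw [this]
  simp [specialize]

lemma DependsOnColumns.projPoly {k : Fin n}
    {G : MvPolynomial (Fin n) (MvPolynomial (Fin n × Fin n) ℝ)}
    (hG : DependsOnColumns ((k : ℕ) + 1) G) (r : ℕ) : DependsOnColumns k (projPoly k G r) := by
  intro v v' hv
  refine MvPolynomial.funext fun y => ?_
  have h1 : specialize v G = specialize v' G := hG v v' fun i l hl => hv i l (by omega)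
  have h2 : (fun i => v (i, k)) = fun i => v' (i, k) := _root_.funext fun i => hv i k le_rfl
  rw [eval_projPoly, eval_projPoly, eval_topCoeff, eval_topCoeff, h1, h2]

lemma topCoeff_ne_zero {k : Fin n} {G : MvPolynomial (Fin n) (MvPolynomial (Fin n × Fin n) ℝ)}
    (hG0 : G ≠ 0) (hG : DependsOnColumns ((k : ℕ) + 1) G) : topCoeff k G ≠ 0 := by
  have hH : homogeneousComponent G.totalDegree G ≠ 0 := by
    obtain ⟨m, hm, hdeg⟩ := Finset.exists_mem_eq_sup G.support (support_nonempty.2 hG0)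
      fun m => m.degree
    intro h0
    have := congrArg (coeff m) h0
    rw [coeff_homogeneousComponent, if_pos, coeff_zero] at this
    · exact mem_support_iff.1 hm this
    · rw [totalDegree]
      exact hdeg.symm
  obtain ⟨m, hm⟩ := ne_zero_iff.1 hH
  obtain ⟨v, hv⟩ : ∃ v : Fin n × Fin n → ℝ,
      eval v (coeff m (homogeneousComponent G.totalDegree G)) ≠ 0 := by
    by_contra! hall
    exact hm (MvPolynomial.funext fun v => by rw [hall v, map_zero])
  obtain ⟨y, hy⟩ : ∃ y : Fin n → ℝ,
      eval y (specialize v (homogeneousComponent G.totalDegree G)) ≠ 0 := by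
    by_contra! hall
    have h0 : specialize v (homogeneousComponent G.totalDegree G) = 0 :=
      MvPolynomial.funext fun y => by rw [hall y, map_zero]
    exact hv (by rw [← coeff_map, ← specialize, h0, coeff_zero])
  let v' : Fin n × Fin n → ℝ := fun x => if x.2 = k then y x.1 else v x
  have hvv : specialize v G = specialize v' G := hG v v' fun i l hl => by
    have : l ≠ k := fun h => by subst h; omega
    simp [v', this]
  intro h0
  apply hy
  have := eval_topCoeff v' k G
  rw [h0, map_zero, ← hvv] at this
  rw [homogeneousComponent_specialize, this]
  simp [v']

lemma isContinuousFamily_lineRestriction {T : Type*} [TopologicalSpace T]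
    {v : Fin n × Fin n → ℝ} {k : Fin n}
    {G : MvPolynomial (Fin n) (MvPolynomial (Fin n × Fin n) ℝ)} (h : eval v (topCoeff k G) ≠ 0)
    {σ : T → Fin n → ℝ} (hσ : Continuous σ) :
    IsContinuousFamily (fun t => lineRestriction (σ t) (fun i => v (i, k)) (specialize v G))
      G.totalDegree (eval v (topCoeff k G)) where
  ne_zero := h
  natDegree_le t := natDegree_lineRestriction_le _ _ (totalDegree_specialize_le v G)
  coeff_eq t := by rw [coeff_lineRestriction _ _ (totalDegree_specialize_le v G), eval_topCoeff]
  continuous_coeff i := (continuous_coeff_lineRestriction _ _ i).comp hσ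

end GenericProjection

section Lifting

variable {n m : ℕ}

/-- The vector with the same first `j` coordinates and zeros elsewhere. -/
def truncate (j : ℕ) (x : Fin n → ℝ) : Fin n → ℝ := fun i => if (i : ℕ) < j then x i else 0

/-- The action on vectors of the matrix with entries `v`. -/
def act (v : Fin n × Fin n → ℝ) (x : Fin n → ℝ) : Fin n → ℝ := fun i => ∑ l, v (i, l) * x l

lemma continuous_act (v : Fin n × Fin n → ℝ) : Continuous (act v) :=
  continuous_pi fun _ => continuous_finsetSum _ fun l _ => continuous_const.mul (continuous_apply l)

lemma continuous_truncate (j : ℕ) : Continuous (truncate j : (Fin n → ℝ) → Fin n → ℝ) :=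
  continuous_pi fun i => by
    unfold truncate
    split_ifs
    · exact continuous_apply i
    · exact continuous_const

lemma truncate_of_le {j : ℕ} (hj : n ≤ j) (x : Fin n → ℝ) : truncate j x = x := by
  ext i
  simp [truncate, i.2.trans_le hj]

lemma truncate_succ_update (k : Fin n) (x : Fin n → ℝ) (s : ℝ) :
    truncate (k + 1) (Function.update x k s) = Function.update (truncate k x) k s := by
  ext i
  rcases eq_or_ne i k with rfl | hi
  · simp [truncate]
  · have hik : (i : ℕ) ≠ k := fun h => hi (Fin.ext h)
    have : (i : ℕ) < k + 1 ↔ (i : ℕ) < k := by omega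
    simp [truncate, hi, this]

lemma act_update_truncate (v : Fin n × Fin n → ℝ) (k : Fin n) (x : Fin n → ℝ) (s : ℝ) :
    act v (Function.update (truncate k x) k s) =
      fun i => act v (truncate k x) i + s * v (i, k) := by
  ext i
  have h : Function.update (truncate k x) k s = truncate k x + Pi.single k s := by
    ext l
    rcases eq_or_ne l k with rfl | hl
    · simp [truncate]
    · simp [hl]
  simp only [act, h, Pi.add_apply, mul_add, Finset.sum_add_distrib]
  have hs : ∑ l, v (i, l) * (Pi.single k s : Fin n → ℝ) l = s * v (i, k) := by
    rw [Finset.sum_eq_single k (fun l _ hl => by simp [hl]) (by simp)]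
    simp [mul_comm]
  rw [hs]

lemma eval_act_truncate_update (v : Fin n × Fin n → ℝ) (k : Fin n) (x : Fin n → ℝ) (s : ℝ)
    (G : MvPolynomial (Fin n) ℝ) :
    eval (act v (truncate (k + 1) (Function.update x k s))) G =
      (lineRestriction (act v (truncate k x)) (fun i => v (i, k)) G).eval s := by
  rw [eval_lineRestriction, truncate_succ_update, act_update_truncate]

/-- Every point over `σ t₀` lies on a continuous lift of the first `j` coordinates of `σ` along
which the vanishing of each `f i` is constant; the lift is bounded if `σ` is. -/
def HasLift (f : Fin m → MvPolynomial (Fin n) ℝ) (v : Fin n × Fin n → ℝ) (j : ℕ)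
    {T : Type} [TopologicalSpace T] (σ : T → Fin n → ℝ) : Prop :=
  ∀ t₀ w, (∀ i : Fin n, (i : ℕ) < j → w i = σ t₀ i) → ∃ τ : T → Fin n → ℝ,
    Continuous τ ∧ (∀ t, ∀ i : Fin n, (i : ℕ) < j → τ t i = σ t i) ∧ τ t₀ = w ∧
    (∀ i t t', eval (act v (τ t)) (f i) = 0 → eval (act v (τ t')) (f i) = 0) ∧
    (Bornology.IsBounded (range σ) → Bornology.IsBounded (range τ))

/-- The vanishing of the members of `F` along `σ` controls lifts of the first `j` coordinates. -/
def ControlsLifts (f : Fin m → MvPolynomial (Fin n) ℝ) (v : Fin n × Fin n → ℝ) (j : ℕ)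
    (F : Finset (MvPolynomial (Fin n) (MvPolynomial (Fin n × Fin n) ℝ))) : Prop :=
  ∀ (T : Type) [TopologicalSpace T] [PreconnectedSpace T] (σ : T → Fin n → ℝ), Continuous σ →
    (∀ φ ∈ F, ∀ t t', eval (act v (truncate j (σ t))) (specialize v φ) = 0 →
      eval (act v (truncate j (σ t'))) (specialize v φ) = 0) → HasLift f v j σ

/-- A continuous function of the coordinates up to `k`, with finitely many zeros in the `k`-th
coordinate, off whose zero set the coordinates up to `k` can be lifted. -/
structure IsLevelFunction (f : Fin m → MvPolynomial (Fin n) ℝ) (v : Fin n × Fin n → ℝ) (k : Fin n)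
    (h : (Fin n → ℝ) → ℝ) : Prop where
  continuous : Continuous h
  congr : ∀ x y : Fin n → ℝ, (∀ i ≤ k, x i = y i) → h x = h y
  finite : ∀ x, {s | h (Function.update x k s) = 0}.Finite
  hasLift : ∀ (T : Type) [TopologicalSpace T] [PreconnectedSpace T] (σ : T → Fin n → ℝ),
    Continuous σ → (∀ t, h (σ t) ≠ 0) → HasLift f v (k + 1) σ

lemma exists_abs_le_of_isBounded_range {T : Type*} {σ : T → Fin n → ℝ}
    (hσ : Bornology.IsBounded (range σ)) {g : (Fin n → ℝ) → ℝ} (hg : Continuous g) :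
    ∃ M, ∀ t, |g (σ t)| ≤ M := by
  obtain ⟨M, hM⟩ := hσ.isCompact_closure.exists_bound_of_continuousOn hg.continuousOn
  exact ⟨M, fun t => hM _ (subset_closure (mem_range_self t))⟩

lemma ControlsLifts.isLevelFunction {f : Fin m → MvPolynomial (Fin n) ℝ} {v : Fin n × Fin n → ℝ}
    {k : Fin n} {F : Finset (MvPolynomial (Fin n) (MvPolynomial (Fin n × Fin n) ℝ))}
    (hF : ControlsLifts f v (k + 1) F) (hG : eval v (topCoeff k (∏ φ ∈ F, φ)) ≠ 0) :
    IsLevelFunction f v k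
      fun x => eval (act v (truncate (k + 1) x)) (specialize v (∏ φ ∈ F, φ)) where
  continuous := (MvPolynomial.continuous_eval _).comp
    ((continuous_act v).comp (continuous_truncate _))
  congr x y hxy := by
    have : truncate (k + 1) x = truncate (k + 1) y := by
      ext i
      unfold truncate
      split_ifs with hi
      · exact hxy i (Fin.le_def.2 (Nat.lt_succ_iff.1 hi))
      · rfl
    rw [this]
  finite x := by
    simp only [eval_act_truncate_update]
    have hfam := isContinuousFamily_lineRestriction hG
      (continuous_const : Continuous fun _ : Unit => act v (truncate k x))
    exact Polynomial.finite_setOfPred_isRoot (hfam.poly_ne_zero ())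
  hasLift T _ _ σ hσ hne := hF T σ hσ fun φ hφ t t' h0 => by
    refine absurd ?_ (hne t)
    rw [map_prod, map_prod]
    exact Finset.prod_eq_zero hφ h0

open Classical in
lemma ControlsLifts.project {f : Fin m → MvPolynomial (Fin n) ℝ} {v : Fin n × Fin n → ℝ}
    {k : Fin n} {F : Finset (MvPolynomial (Fin n) (MvPolynomial (Fin n × Fin n) ℝ))}
    (hF : ControlsLifts f v (k + 1) F) (hG : eval v (topCoeff k (∏ φ ∈ F, φ)) ≠ 0)
    (hφ : ∀ φ ∈ F, eval v (topCoeff k φ) ≠ 0) :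
    ControlsLifts f v k (((Finset.range ((∏ φ ∈ F, φ).totalDegree + 1)).image
      (projPoly k (∏ φ ∈ F, φ))).filter (· ≠ 0)) := by
  intro T _ _ σ hσ hconst t₀ w hw
  set G := ∏ φ ∈ F, φ with hGdef
  have hσk : Continuous fun t => act v (truncate k (σ t)) :=
    (continuous_act v).comp ((continuous_truncate _).comp hσ)
  have hfam := isContinuousFamily_lineRestriction hG hσk
  have hvanish : ∀ r ≤ G.totalDegree, ∀ t t',
      coeffSubdiscriminant G.totalDegree r (lineRestriction (act v (truncate k (σ t)))
        (fun i => v (i, k)) (specialize v G)) (eval v (topCoeff k G)) = 0 →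
      coeffSubdiscriminant G.totalDegree r (lineRestriction (act v (truncate k (σ t')))
        (fun i => v (i, k)) (specialize v G)) (eval v (topCoeff k G)) = 0 := by
    intro r hr t t'
    rw [← eval_projPoly, ← eval_projPoly]
    by_cases h0 : projPoly k G r = 0
    · simp [h0]
    · exact hconst _ (Finset.mem_filter.2 ⟨Finset.mem_image_of_mem _
        (Finset.mem_range.2 (Nat.lt_succ_of_le hr)), h0⟩) t t'
  have hcard : ∀ t t', (complexRoots (lineRestriction (act v (truncate k (σ t)))
        (fun i => v (i, k)) (specialize v G))).card =
      (complexRoots (lineRestriction (act v (truncate k (σ t')))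
        (fun i => v (i, k)) (specialize v G))).card := fun t t' =>
    card_complexRoots_eq hG (hfam.natDegree_eq t) (hfam.natDegree_eq t') (hfam.leadingCoeff_eq t)
      (hfam.leadingCoeff_eq t') fun r hr => ⟨hvanish r hr t t', hvanish r hr t' t⟩
  obtain ⟨θ, hθ, hθ₀, hfac, hbdd⟩ := hfam.exists_lift hcard t₀ (w k)
  have hσ₁ : Continuous fun t => Function.update (σ t) k (θ t) := hσ.update k hθ
  obtain ⟨σ', hσ', hext, hσ'₀, hf, hσ'b⟩ := hF T _ hσ₁ (fun φ hφF t t' h0 => by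
    rw [eval_act_truncate_update] at h0 ⊢
    exact hfac _ _ _ (isContinuousFamily_lineRestriction (hφ φ hφF) hσk)
      (fun t => map_dvd (lineRestriction _ _) (map_dvd (specialize v)
        (Finset.dvd_prod_of_mem _ hφF))) t t' h0) t₀ w (fun i hi => by
    rcases eq_or_ne i k with rfl | hik
    · simp [hθ₀]
    · have : (i : ℕ) ≠ k := fun h => hik (Fin.ext h)
      rw [Function.update_of_ne hik]
      exact hw i (by omega))
  refine ⟨σ', hσ', fun t i hi => ?_, hσ'₀, hf, fun hb => hσ'b ?_⟩
  · have hik : i ≠ k := fun h => by subst h; exact lt_irrefl _ hi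
    exact (hext t i (by omega)).trans (Function.update_of_ne hik _ _)
  · have hcoeff : ∃ M, ∀ t i, |(lineRestriction (act v (truncate k (σ t)))
        (fun i => v (i, k)) (specialize v G)).coeff i| ≤ M := by
      choose M hM using fun i => exists_abs_le_of_isBounded_range hb
        ((continuous_coeff_lineRestriction (fun i => v (i, k)) (specialize v G) i).comp
          ((continuous_act v).comp (continuous_truncate k)))
      refine ⟨∑ i ∈ Finset.range (G.totalDegree + 1), |M i|, fun t i => ?_⟩
      by_cases hi : i ∈ Finset.range (G.totalDegree + 1)
      · exact (hM i t).trans ((le_abs_self _).trans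
          (Finset.single_le_sum (f := fun i => |M i|) (fun i _ => abs_nonneg _) hi))
      · rw [Polynomial.coeff_eq_zero_of_natDegree_lt, abs_zero]
        · exact Finset.sum_nonneg fun i _ => abs_nonneg _
        · refine (hfam.natDegree_le t).trans_lt ?_
          rw [Finset.mem_range] at hi
          omega
    obtain ⟨R, hR⟩ := hbdd hcoeff
    obtain ⟨M, hM⟩ := isBounded_iff_forall_norm_le.1 hb
    refine isBounded_iff_forall_norm_le.2 ⟨max M R, ?_⟩
    rintro _ ⟨t, rfl⟩
    have hMt := hM _ (mem_range_self t)
    have h0 : 0 ≤ max M R := ((norm_nonneg _).trans hMt).trans (le_max_left _ _)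
    refine (pi_norm_le_iff_of_nonneg h0).2 fun i => ?_
    rcases eq_or_ne i k with rfl | hik
    · simpa using Or.inr (hR t)
    · simpa [hik] using Or.inl ((norm_le_pi_norm (σ t) i).trans hMt)

lemma DependsOnColumns.prod {j : ℕ}
    {F : Finset (MvPolynomial (Fin n) (MvPolynomial (Fin n × Fin n) ℝ))}
    (hF : ∀ φ ∈ F, DependsOnColumns j φ) : DependsOnColumns j (∏ φ ∈ F, φ) := by
  intro v v' hv
  rw [map_prod, map_prod]
  exact Finset.prod_congr rfl fun φ hφ => hF φ hφ v v' hv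

open Classical in
lemma exists_controlsLifts (f : Fin m → MvPolynomial (Fin n) ℝ) {j : ℕ} (hj : j ≤ n) :
    ∃ q : MvPolynomial (Fin n × Fin n) ℝ, q ≠ 0 ∧
      ∃ F : Finset (MvPolynomial (Fin n) (MvPolynomial (Fin n × Fin n) ℝ)),
        (∀ φ ∈ F, φ ≠ 0 ∧ DependsOnColumns j φ) ∧ ∀ v, eval v q ≠ 0 →
          ControlsLifts f v j F ∧ ∀ k : Fin n, j ≤ k → ∃ h, IsLevelFunction f v k h := by
  induction hj using Nat.decreasingInduction with
  | self =>
    have hspec : ∀ v i, specialize v (map C (f i)) = f i := fun v i => by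
      have : (eval v).comp C = RingHom.id ℝ := by ext a; simp
      rw [specialize, map_map, this, map_id]
    refine ⟨1, one_ne_zero, (Finset.univ.image fun i => map C (f i)).filter (· ≠ 0), ?_, ?_⟩
    · intro φ hφ
      rw [Finset.mem_filter, Finset.mem_image] at hφ
      obtain ⟨⟨i, -, rfl⟩, h0⟩ := hφ
      exact ⟨h0, fun v v' _ => by rw [hspec, hspec]⟩
    · refine fun v _ => ⟨fun T _ _ σ hσ hconst t₀ w hw => ?_, fun k hk => absurd k.2 (by omega)⟩
      refine ⟨σ, hσ, fun t i _ => rfl, (_root_.funext fun i => hw i i.2).symm,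
        fun i t t' h0 => ?_, id⟩
      by_cases hi : map C (f i) = (0 : MvPolynomial (Fin n) (MvPolynomial (Fin n × Fin n) ℝ))
      · rw [← hspec v i, hi]
        simp
      · have := hconst (map C (f i)) (Finset.mem_filter.2
          ⟨Finset.mem_image_of_mem _ (Finset.mem_univ i), hi⟩) t t'
        rw [hspec, truncate_of_le le_rfl, truncate_of_le le_rfl] at this
        exact this h0
  | of_succ j hj ih =>
    obtain ⟨q, hq, F, hF, hlift⟩ := ih
    let k : Fin n := ⟨j, hj⟩
    have hG0 : ∏ φ ∈ F, φ ≠ 0 := Finset.prod_ne_zero_iff.2 fun φ hφ => (hF φ hφ).1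
    have hGdep : DependsOnColumns ((k : ℕ) + 1) (∏ φ ∈ F, φ) :=
      DependsOnColumns.prod fun φ hφ => (hF φ hφ).2
    refine ⟨q * (topCoeff k (∏ φ ∈ F, φ) * ∏ φ ∈ F, topCoeff k φ), mul_ne_zero hq (mul_ne_zero
      (topCoeff_ne_zero hG0 hGdep) (Finset.prod_ne_zero_iff.2 fun φ hφ =>
        topCoeff_ne_zero (hF φ hφ).1 (hF φ hφ).2)),
      ((Finset.range ((∏ φ ∈ F, φ).totalDegree + 1)).image
        (projPoly k (∏ φ ∈ F, φ))).filter (· ≠ 0), ?_, fun v hv => ?_⟩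
    rotate_left
    · rw [map_mul, map_mul, map_prod] at hv
      obtain ⟨hvq, hv⟩ := mul_ne_zero_iff.1 hv
      obtain ⟨hvG, hvF⟩ := mul_ne_zero_iff.1 hv
      obtain ⟨hctrl, hlevel⟩ := hlift v hvq
      refine ⟨ControlsLifts.project (k := k) hctrl hvG (Finset.prod_ne_zero_iff.1 hvF),
        fun l hl => ?_⟩
      rcases eq_or_lt_of_le hl with heq | hlt
      · obtain rfl : k = l := Fin.ext heq
        exact ⟨_, ControlsLifts.isLevelFunction (k := k) hctrl hvG⟩
      · exact hlevel l hlt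
    · intro φ hφ
      rw [Finset.mem_filter, Finset.mem_image] at hφ
      obtain ⟨⟨r, -, rfl⟩, h0⟩ := hφ
      exact ⟨h0, hGdep.projPoly r⟩

end Lifting

section ConnectedComponents

variable {n m : ℕ}

lemma InBoolAlg.mem_iff {α : Type*} {G : Set (Set α)} {P : Set α} (hP : InBoolAlg G P) {x y : α}
    (h : ∀ S ∈ G, (x ∈ S ↔ y ∈ S)) : x ∈ P ↔ y ∈ P := by
  induction hP with
  | basic s hs => exact h s hs
  | compl s _ ih => exact not_congr ih
  | union s t _ _ ihs iht => exact or_congr ihs iht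
  | inter s t _ _ ihs iht => exact and_congr ihs iht

lemma pos_of_pos_of_forall_ne_zero {T : Type*} [TopologicalSpace T] [PreconnectedSpace T]
    {g : T → ℝ} (hg : Continuous g) (hne : ∀ t, g t ≠ 0) {t : T} (ht : 0 < g t) (t' : T) :
    0 < g t' := by
  by_contra! hle
  obtain ⟨u, hu⟩ := mem_range_of_exists_le_of_exists_ge hg ⟨t', hle⟩ ⟨t, ht.le⟩
  exact hne u hu

/-- Membership in `P` depends only on the signs of the `f i` after the action of `v`. -/
def SignInvariant (f : Fin m → MvPolynomial (Fin n) ℝ) (v : Fin n × Fin n → ℝ)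
    (P : Set (Fin n → ℝ)) : Prop :=
  ∀ x y, (∀ i, (0 < eval (act v x) (f i) ↔ 0 < eval (act v y) (f i)) ∧
    (eval (act v x) (f i) = 0 ↔ eval (act v y) (f i) = 0)) → x ∈ P → y ∈ P

variable {f : Fin m → MvPolynomial (Fin n) ℝ} {v : Fin n × Fin n → ℝ} {P : Set (Fin n → ℝ)}

lemma SignInvariant.mem_of_path (hP : SignInvariant f v P) {T : Type*} [TopologicalSpace T]
    [PreconnectedSpace T] {σ : T → Fin n → ℝ} (hσ : Continuous σ)
    (hf : ∀ i t t', eval (act v (σ t)) (f i) = 0 → eval (act v (σ t')) (f i) = 0)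
    {t₀ : T} (ht₀ : σ t₀ ∈ P) (t : T) : σ t ∈ P := by
  refine hP _ _ (fun i => ⟨?_, hf i _ _, hf i _ _⟩) ht₀
  have hc : Continuous fun t => eval (act v (σ t)) (f i) :=
    (MvPolynomial.continuous_eval _).comp ((continuous_act v).comp hσ)
  constructor <;> intro h0
  · exact pos_of_pos_of_forall_ne_zero hc (fun u hu => h0.ne' (hf i _ _ hu)) h0 _
  · exact pos_of_pos_of_forall_ne_zero hc (fun u hu => h0.ne' (hf i _ _ hu)) h0 _

variable {p x₀ : Fin n → ℝ} {k : Fin n}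

/-- The connected component of `x₀` in the part of `P` with first coordinates given by `p`. -/
def fiberComponent (P : Set (Fin n → ℝ)) (p : Fin n → ℝ) (k : Fin n) (x₀ : Fin n → ℝ) :
    Set (Fin n → ℝ) :=
  connectedComponentIn (P ∩ {x | ∀ j : Fin n, j < k → x j = p j}) x₀

lemma apply_eq_of_mem_closure_fiberComponent {x : Fin n → ℝ}
    (hx : x ∈ closure (fiberComponent P p k x₀)) {j : Fin n} (hj : j < k) : x j = p j :=
  closure_minimal (fun _ hy => (connectedComponentIn_subset _ _ hy).2 j hj)
    (isClosed_eq (continuous_apply j) continuous_const) hx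

/-- A lift starting in a component of a fiber stays in it. -/
lemma HasLift.exists_fiberComponent (hP : SignInvariant f v P) {T : Type} [TopologicalSpace T]
    [PreconnectedSpace T] {σ : T → Fin n → ℝ} {j : ℕ} (hσ : HasLift f v j σ) (hkj : (k : ℕ) ≤ j)
    (hp : ∀ t, ∀ i : Fin n, i < k → σ t i = p i) {t₀ : T} {w : Fin n → ℝ}
    (hw : w ∈ fiberComponent P p k x₀) (hwσ : ∀ i : Fin n, (i : ℕ) < j → w i = σ t₀ i) :
    ∃ σ' : T → Fin n → ℝ, Continuous σ' ∧
      (∀ t, ∀ i : Fin n, (i : ℕ) < j → σ' t i = σ t i) ∧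
      (∀ t, σ' t ∈ fiberComponent P p k x₀) ∧
      (Bornology.IsBounded (range σ) → Bornology.IsBounded (range σ')) := by
  obtain ⟨σ', hσ', hext, rfl, hf, hb⟩ := hσ t₀ w hwσ
  refine ⟨σ', hσ', hext, fun t => ?_, hb⟩
  have hsub : range σ' ⊆ P ∩ {x | ∀ j : Fin n, j < k → x j = p j} := by
    rintro _ ⟨u, rfl⟩
    refine ⟨hP.mem_of_path hσ' hf (connectedComponentIn_subset _ _ hw).1 u, fun i hi => ?_⟩
    exact (hext u i (lt_of_lt_of_le hi hkj)).trans (hp u i hi)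
  rw [fiberComponent, connectedComponentIn_eq hw]
  exact (isPreconnected_range hσ').subset_connectedComponentIn (mem_range_self t₀) hsub
    (mem_range_self t)

/-- Near a point of the closure where a level function does not vanish, the `k`-th coordinate
takes all nearby values on the component. -/
lemma IsLevelFunction.exists_mem_fiberComponent (hP : SignInvariant f v P) {j : Fin n}
    {h : (Fin n → ℝ) → ℝ} (hh : IsLevelFunction f v j h) (hkj : k ≤ j) {x : Fin n → ℝ}
    (hx : x ∈ closure (fiberComponent P p k x₀)) (hne : h x ≠ 0) :
    ∃ δ > 0, ∀ s, |s| < δ → ∃ y ∈ fiberComponent P p k x₀, y k = x k + s := by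
  obtain ⟨δ, hδ, hball⟩ := Metric.isOpen_iff.1
    (isOpen_ne_fun hh.continuous (continuous_const (y := (0 : ℝ)))) x hne
  let S : Set (Fin n → ℝ) := Metric.ball x δ ∩ {y | ∀ i : Fin n, i < k → y i = p i}
  have hconv : Convex ℝ S := by
    refine (convex_ball x δ).inter fun y hy z hz a b _ _ hab i hi => ?_
    simp only [Pi.add_apply, Pi.smul_apply, smul_eq_mul, hy i hi, hz i hi, ← add_mul, hab, one_mul]
  have : PreconnectedSpace S := Subtype.preconnectedSpace hconv.isPreconnected
  obtain ⟨w, hwC, hwx⟩ := Metric.mem_closure_iff.1 hx δ hδ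
  have hwS : w ∈ S := ⟨by rwa [Metric.mem_ball, dist_comm],
    fun i hi => (connectedComponentIn_subset _ _ hwC).2 i hi⟩
  obtain ⟨σ', -, hext, hmem, -⟩ := HasLift.exists_fiberComponent (T := S) (p := p) (t₀ := ⟨w, hwS⟩)
    hP (hh.hasLift S Subtype.val continuous_subtype_val fun t => hball t.2.1)
    ((Fin.le_def.1 hkj).trans (Nat.le_succ _)) (fun t i hi => t.2.2 i hi) hwC (fun _ _ => rfl)
  refine ⟨δ, hδ, fun s hs => ?_⟩
  have hyS : Function.update x k (x k + s) ∈ S := by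
    refine ⟨?_, fun i hi => ?_⟩
    · refine (dist_pi_lt_iff hδ).2 fun i => ?_
      rcases eq_or_ne i k with rfl | hik
      · simpa [Real.dist_eq] using hs
      · simpa [hik] using hδ
    · rw [Function.update_of_ne hi.ne]
      exact apply_eq_of_mem_closure_fiberComponent hx hi
  refine ⟨_, hmem ⟨_, hyS⟩, ?_⟩
  rw [hext _ k (Nat.lt_succ_of_le (Fin.le_def.1 hkj))]
  exact Function.update_self _ _ _

lemma IsLevelFunction.eq_zero_of_mem_ZZ (hP : SignInvariant f v P) {j : Fin n}
    {h : (Fin n → ℝ) → ℝ} (hh : IsLevelFunction f v j h) (hkj : k ≤ j) {x : Fin n → ℝ}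
    (hx : x ∈ ZZ (fiberComponent P p k x₀) k) : h x = 0 := by
  by_contra hne
  rcases hx with ⟨hx, hb, hxk⟩ | ⟨hx, hb, hxk⟩
  · obtain ⟨δ, hδ, hy⟩ := hh.exists_mem_fiberComponent hP hkj hx hne
    obtain ⟨y, hyC, hyk⟩ := hy (-(δ / 2)) (by rw [abs_neg, abs_of_pos] <;> linarith)
    have := csInf_le hb (mem_image_of_mem (fun x : Fin n → ℝ => x k) hyC)
    linarith
  · obtain ⟨δ, hδ, hy⟩ := hh.exists_mem_fiberComponent hP hkj hx hne
    obtain ⟨y, hyC, hyk⟩ := hy (δ / 2) (by rw [abs_of_pos] <;> linarith)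
    have := le_csSup hb (mem_image_of_mem (fun x : Fin n → ℝ => x k) hyC)
    linarith

/-- A set of vectors is finite if every coordinate takes finitely many values once the previous
ones are fixed. -/
lemma finite_of_forall_finite_coordinate {A : Set (Fin n → ℝ)}
    (hA : ∀ j : Fin n, ∀ y : Fin n → ℝ, {s | ∃ x ∈ A, (∀ i < j, x i = y i) ∧ x j = s}.Finite) :
    A.Finite := by
  have htrunc : ∀ j ≤ n, (truncate j '' A).Finite := by
    intro j
    induction j with
    | zero =>
      refine fun _ => (finite_singleton (0 : Fin n → ℝ)).subset ?_
      rintro _ ⟨x, -, rfl⟩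
      ext i
      simp [truncate]
    | succ j ih =>
      intro hj
      let k : Fin n := ⟨j, hj⟩
      refine ((ih (Nat.le_of_succ_le hj)).biUnion fun y _ =>
        (hA k y).image fun s => Function.update y k s).subset ?_
      rintro _ ⟨x, hx, rfl⟩
      refine mem_biUnion (mem_image_of_mem _ hx) ⟨x k, ⟨x, hx, fun i hi => ?_, rfl⟩, ?_⟩
      · exact (if_pos (Fin.lt_def.1 hi)).symm
      · have := truncate_succ_update k x (x k)
        rw [Function.update_eq_self] at this
        exact this.symm
  have := htrunc n le_rfl
  rwa [image_congr fun x _ => truncate_of_le le_rfl x, image_id'] at this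

lemma finite_ZZ_fiberComponent (hP : SignInvariant f v P)
    (hlevel : ∀ j : Fin n, ∃ h, IsLevelFunction f v j h) :
    (ZZ (fiberComponent P p k x₀) k).Finite := by
  refine finite_of_forall_finite_coordinate fun j y => ?_
  rcases lt_or_ge j k with hj | hj
  · refine (finite_singleton (p j)).subset ?_
    rintro _ ⟨x, hx, -, rfl⟩
    exact apply_eq_of_mem_closure_fiberComponent (hx.elim And.left And.left) hj
  · obtain ⟨h, hh⟩ := hlevel j
    refine (hh.finite y).subset ?_
    rintro _ ⟨x, hx, hxy, rfl⟩
    rw [mem_ofPred_eq, ← hh.eq_zero_of_mem_ZZ hP hj hx]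
    refine hh.congr _ _ fun i hi => ?_
    rcases eq_or_lt_of_le hi with rfl | hlt
    · simp
    · rw [Function.update_of_ne hlt.ne, hxy i hlt]

/-- The limit of a bounded lift of a segment ending at `c`. -/
lemma exists_mem_closure_of_lift {C : Set (Fin n → ℝ)} {I : Set ℝ} {c : ℝ} (hc : c ∈ closure I)
    {σ : I → Fin n → ℝ} (hmem : ∀ t, σ t ∈ C) (hk : ∀ t : I, σ t k = t)
    (hb : Bornology.IsBounded (range σ)) : ∃ x ∈ closure C, x k = c := by
  have hK : IsCompact ((fun x : Fin n → ℝ => x k) '' closure (range σ)) :=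
    hb.isCompact_closure.image (continuous_apply k)
  have hI : I ⊆ (fun x : Fin n → ℝ => x k) '' closure (range σ) := fun t ht =>
    ⟨σ ⟨t, ht⟩, subset_closure (mem_range_self _), hk ⟨t, ht⟩⟩
  obtain ⟨x, hx, hxc⟩ := closure_minimal hI hK.isClosed hc
  exact ⟨x, closure_mono (range_subset_iff.2 hmem) hx, hxc⟩

lemma IsLevelFunction.exists_mem_closure_fiberComponent (hP : SignInvariant f v P)
    {h : (Fin n → ℝ) → ℝ} (hh : IsLevelFunction f v k h) {c : ℝ}
    (hc : c ∈ closure (projK k (fiberComponent P p k x₀))) :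
    ∃ x ∈ closure (fiberComponent P p k x₀), x k = c := by
  have hfin := (hh.finite p).subset (sdiff_subset (t := {c}))
  obtain ⟨ε, hε, hball⟩ := Metric.isOpen_iff.1 hfin.isClosed.isOpen_compl c (by simp)
  obtain ⟨_, ⟨w, hw, rfl⟩, hwc⟩ := Metric.mem_closure_iff.1 hc ε hε
  rw [Real.dist_eq, abs_lt] at hwc
  dsimp only at hwc
  have hseg : ∀ a b : ℝ, c - ε ≤ a → b ≤ c + ε → c ∉ Ioo a b → w k ∈ Ioo a b →
      c ∈ closure (Ioo a b) → ∃ x ∈ closure (fiberComponent P p k x₀), x k = c := by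
    intro a b ha hb hcab hwab hcl
    have : PreconnectedSpace (Ioo a b) := Subtype.preconnectedSpace isPreconnected_Ioo
    have hwp : ∀ i : Fin n, i < k → w i = p i := fun i hi =>
      (connectedComponentIn_subset _ _ hw).2 i hi
    have hcont : Continuous fun t : ℝ => Function.update w k t :=
      continuous_const.update k continuous_id
    have hne : ∀ t : Ioo a b, h (Function.update w k t) ≠ 0 := by
      intro t h0
      have htc : (t : ℝ) ≠ c := fun htc => hcab (htc ▸ t.2)
      refine hball (a := (t : ℝ)) ?_ ⟨?_, htc⟩
      · rw [Metric.mem_ball, Real.dist_eq, abs_lt]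
        constructor <;> linarith [t.2.1, t.2.2]
      · rw [mem_ofPred_eq, ← h0]
        refine hh.congr _ _ fun i hi => ?_
        rcases eq_or_lt_of_le hi with rfl | hlt
        · simp
        · rw [Function.update_of_ne hlt.ne, Function.update_of_ne hlt.ne, hwp i hlt]
    obtain ⟨σ', -, hext, hmem, hbdd⟩ := HasLift.exists_fiberComponent (T := Ioo a b) (p := p)
      (t₀ := ⟨w k, hwab⟩) hP
      (hh.hasLift (Ioo a b) _ (hcont.comp continuous_subtype_val) hne) (Nat.le_succ _)
      (fun t i hi => (Function.update_of_ne hi.ne _ _).trans (hwp i hi)) hw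
      (fun i _ => by simp)
    refine exists_mem_closure_of_lift hcl hmem (fun t => ?_) (hbdd ?_)
    · rw [hext t k (Nat.lt_succ_self _)]
      exact Function.update_self _ _ _
    · refine (((isCompact_Icc (a := a) (b := b)).image hcont).isBounded).subset ?_
      rintro _ ⟨t, rfl⟩
      exact ⟨t, Ioo_subset_Icc_self t.2, rfl⟩
  rcases lt_trichotomy (w k) c with hlt | heq | hgt
  · refine hseg (c - ε) c le_rfl (by linarith) (fun h => lt_irrefl _ h.2)
      ⟨by linarith, hlt⟩ ?_
    rw [closure_Ioo (by linarith)]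
    exact ⟨by linarith, le_rfl⟩
  · exact ⟨w, subset_closure hw, heq⟩
  · refine hseg c (c + ε) (by linarith) le_rfl (fun h => lt_irrefl _ h.1)
      ⟨hgt, by linarith⟩ ?_
    rw [closure_Ioo (by linarith)]
    exact ⟨le_rfl, by linarith⟩

end ConnectedComponents

theorem statement0 (n m : ℕ) (f : Fin m → MvPolynomial (Fin n) ℝ) :
    ∃ q : MvPolynomial (Fin n × Fin n) ℝ, q ≠ 0 ∧
      ∀ V : Matrix (Fin n) (Fin n) ℚ,
        eval (fun ij => ((V ij.1 ij.2 : ℚ) : ℝ)) q ≠ 0 →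
          IsUnit V ∧
          ∀ P : Set (Fin n → ℝ),
            InBoolAlg {S | ∃ i : Fin m,
                S = {x | 0 < eval ((V.map ((↑) : ℚ → ℝ)).mulVec x) (f i)} ∨
                S = {x | eval ((V.map ((↑) : ℚ → ℝ)).mulVec x) (f i) = 0}} P →
            ∀ p : Fin n → ℝ, ∀ k : Fin n,
              ∀ Pk : Set (Fin n → ℝ),
                Pk = P ∩ {x | ∀ j : Fin n, j < k → x j = p j} →
                  ∀ x₀ ∈ Pk, ∀ C : Set (Fin n → ℝ), C = connectedComponentIn Pk x₀ →
                    (ZZ C k).Finite ∧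
                    (BddBelow (projK k C) → (Zinf C k).Nonempty) ∧
                    (BddAbove (projK k C) → (Zsup C k).Nonempty) := by
  obtain ⟨q, hq, _, -, hlift⟩ := exists_controlsLifts f (Nat.zero_le n)
  refine ⟨(Matrix.mvPolynomialX (Fin n) (Fin n) ℝ).det * q,
    mul_ne_zero (Matrix.det_mvPolynomialX_ne_zero (Fin n) ℝ) hq, fun V hV => ?_⟩
  rw [map_mul] at hV
  obtain ⟨hdet, hVq⟩ := mul_ne_zero_iff.1 hV
  refine ⟨?_, ?_⟩
  · rw [Matrix.isUnit_iff_isUnit_det, isUnit_iff_ne_zero]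
    intro h0
    refine hdet ?_
    have hmap : (eval fun ij : Fin n × Fin n => ((V ij.1 ij.2 : ℚ) : ℝ)).mapMatrix
        (Matrix.mvPolynomialX (Fin n) (Fin n) ℝ) = (Rat.castHom ℝ).mapMatrix V := by
      ext i j
      simp [Matrix.mvPolynomialX]
    rw [RingHom.map_det, hmap, ← RingHom.map_det, h0, map_zero]
  · intro P hP p k Pk hPk x₀ hx₀ C hC
    have hlevel := fun j => (hlift _ hVq).2 j (Nat.zero_le _)
    have hinv : SignInvariant f (fun ij => ((V ij.1 ij.2 : ℚ) : ℝ)) P := by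
      intro x y hxy
      refine (hP.mem_iff ?_).1
      rintro S ⟨i, rfl | rfl⟩
      · exact (hxy i).1
      · exact (hxy i).2
    obtain rfl : C = fiberComponent P p k x₀ := by rw [hC, hPk, fiberComponent]
    have hne : (projK k (fiberComponent P p k x₀)).Nonempty :=
      ⟨x₀ k, x₀, mem_connectedComponentIn (hPk ▸ hx₀), rfl⟩
    obtain ⟨h, hh⟩ := hlevel k
    refine ⟨finite_ZZ_fiberComponent hinv hlevel, fun hb => ?_, fun hb => ?_⟩
    · obtain ⟨x, hx, hxk⟩ :=
        hh.exists_mem_closure_fiberComponent hinv (csInf_mem_closure hne hb)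
      exact ⟨x, hx, hb, hxk⟩
    · obtain ⟨x, hx, hxk⟩ :=
        hh.exists_mem_closure_fiberComponent hinv (csSup_mem_closure hne hb)
      exact ⟨x, hx, hb, hxk⟩
end

section
/- Let f_1,…,f_m ∈ ℝ[x_1,…,x_n]. There exists a nonzero polynomial q, with real coefficients, in the n² entries of an n×n matrix, such that every matrix V ∈ ℚ^{n×n} with q(V) ≠ 0 is invertible and has the following property. For every set 𝒫 ⊆ ℝⁿ belonging to the Boolean algebra of subsets of ℝⁿ generated by the sets {x : f_i(Vx) > 0} and {x : f_i(Vx) = 0} (1 ≤ i ≤ m), and every point p = (p_1,…,p_n) ∈ ℝⁿ, the set {p} ∪ ⋃_{k=1}^{n} ⋃_{C ∈ 𝒫(k,p)} Z(C,k) is finite and intersects the Euclidean closure of every connected component of 𝒫, where 𝒫(k,p) denotes the set of all connected components of 𝒫 ∩ {x : x_1 = p_1, …, x_{k−1} = p_{k−1}}. -/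
open MvPolynomial Set

namespace Sampling

/-- The sum over all `r`-tuples of variables of the product of their pairwise differences. -/
noncomputable def tupleDisc (d r : ℕ) : MvPolynomial (Fin d) ℤ :=
  ∑ s : Fin r → Fin d, ∏ a ∈ (Finset.univ : Finset (Fin r)).offDiag, (X (s a.1) - X (s a.2))

theorem tupleDisc_isSymmetric (d r : ℕ) : (tupleDisc d r).IsSymmetric := by
  intro e
  simp only [tupleDisc, map_sum, map_prod, map_sub, rename_X]
  exact Fintype.sum_equiv (Equiv.arrowCongr (Equiv.refl _) e) _ _ fun s => rfl

theorem exists_aeval_esymm_eq_tupleDisc (d r : ℕ) : ∃ E : MvPolynomial (Fin d) ℤ,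
    aeval (fun i : Fin d => esymm (Fin d) ℤ (i + 1)) E = tupleDisc d r := by
  obtain ⟨E, hE⟩ := esymmAlgHom_fin_surjective (R := ℤ) (n := d) (m := d) le_rfl
    ⟨tupleDisc d r, tupleDisc_isSymmetric d r⟩
  exact ⟨E, by rw [← esymmAlgHom_apply, hE]⟩

/-- The polynomial expressing `tupleDisc` through the elementary symmetric polynomials. -/
noncomputable def tupleDiscEsymm (d r : ℕ) : MvPolynomial (Fin d) ℤ :=
  (exists_aeval_esymm_eq_tupleDisc d r).choose

theorem aeval_esymm_tupleDiscEsymm (d r : ℕ) :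
    aeval (fun i : Fin d => esymm (Fin d) ℤ (i + 1)) (tupleDiscEsymm d r) = tupleDisc d r :=
  (exists_aeval_esymm_eq_tupleDisc d r).choose_spec

section

variable {R S : Type*} [CommRing R] [CommRing S]

/-- The value of `tupleDisc` at the roots of `p`, a polynomial of degree at most `d`, each root
being multiplied by the coefficient of degree `d`; it is a polynomial in the coefficients. -/
noncomputable def coeffDisc (d r : ℕ) (p : Polynomial R) : R :=
  aeval (fun i : Fin d => (-1) ^ (i + 1 : ℕ) * p.coeff (d - (i + 1)) * p.coeff d ^ (i : ℕ))
    (tupleDiscEsymm d r)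

theorem map_coeffDisc (d r : ℕ) (φ : R →+* S) (p : Polynomial R) :
    φ (coeffDisc d r p) = coeffDisc d r (p.map φ) := by
  simp only [coeffDisc, aeval_def, eval₂_comp_left φ, Polynomial.coeff_map]
  congr 1
  · exact Subsingleton.elim _ _
  · ext i; simp

theorem aeval_tupleDisc (d r : ℕ) (x : Fin d → R) : aeval x (tupleDisc d r) =
    ∑ s : Fin r → Fin d, ∏ a ∈ (Finset.univ : Finset (Fin r)).offDiag, (x (s a.1) - x (s a.2)) := by
  simp [tupleDisc]

theorem coeffDisc_prod (d r : ℕ) (c : R) (x : Fin d → R) :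
    coeffDisc d r (Polynomial.C c * ∏ i, (Polynomial.X - Polynomial.C (x i))) =
      aeval (fun i => c * x i) (tupleDisc d r) := by
  rw [← aeval_esymm_tupleDiscEsymm, coeffDisc, ← AlgHom.comp_apply, comp_aeval]
  congr 2
  ext i
  have hprod : ∏ i, (Polynomial.X - Polynomial.C (x i)) =
      ((Finset.univ.val.map x).map fun t => Polynomial.X - Polynomial.C t).prod := by
    rw [Multiset.map_map]; rfl
  have hcard : (Finset.univ.val.map x).card = d := by simp
  rw [aeval_esymm_eq_multiset_esymm, hprod, Polynomial.coeff_C_mul, Polynomial.coeff_C_mul,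
    Multiset.prod_X_sub_C_coeff _ (by simp), Multiset.prod_X_sub_C_coeff _ (by simp), hcard]
  have h1 : d - (d - (i + 1)) = (i : ℕ) + 1 := by have := i.2; omega
  have h2 : Finset.univ.val.map (fun i => c * x i) = (Finset.univ.val.map x).map (c • ·) := by
    rw [Multiset.map_map]; rfl
  rw [h1, h2, ← Multiset.pow_smul_esymm, Nat.sub_self]
  have h3 : ((-1 : R) ^ (i + 1 : ℕ)) * (-1) ^ (i + 1 : ℕ) = 1 := by
    rw [← mul_pow]; simp
  have h4 : (Finset.univ.val.map x).esymm 0 = 1 := by simp [Multiset.esymm]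
  simp only [h4, smul_eq_mul, pow_zero, mul_one]
  linear_combination (c ^ (i + 1 : ℕ) * ((Finset.univ.val.map x).esymm (i + 1))) * h3

end

section

variable {K : Type*} [Field K] [DecidableEq K]

theorem aeval_tupleDisc_eq_zero {d r : ℕ} (x : Fin d → K)
    (h : (Finset.univ.image x).card < r) : aeval x (tupleDisc d r) = 0 := by
  rw [aeval_tupleDisc]
  refine Finset.sum_eq_zero fun s _ => ?_
  obtain ⟨a, -, b, -, hab, he⟩ := Finset.exists_ne_map_eq_of_card_lt_of_maps_to
    (s := (Finset.univ : Finset (Fin r))) (t := Finset.univ.image x) (f := fun a => x (s a))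
    (by simpa using h) (fun a _ => by simp)
  exact Finset.prod_eq_zero (i := (a, b)) (by simpa using hab) (sub_eq_zero.2 he)

theorem aeval_tupleDisc_ne_zero [CharZero K] {d : ℕ} (x : Fin d → K) :
    aeval x (tupleDisc d (Finset.univ.image x).card) ≠ 0 := by
  set S := Finset.univ.image x with hS
  set r := S.card with hr
  have key : ∀ s : Fin r → Fin d,
      ∏ a ∈ (Finset.univ : Finset (Fin r)).offDiag, (x (s a.1) - x (s a.2)) =
      if Function.Injective (x ∘ s) then ∏ w ∈ S.offDiag, (w.1 - w.2) else 0 := by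
    intro s
    split_ifs with hs
    · have himg : Finset.univ.image (x ∘ s) = S := by
        apply Finset.eq_of_subset_of_card_le
        · intro y; simp only [Finset.mem_image, hS]; rintro ⟨a, -, rfl⟩
          exact ⟨s a, Finset.mem_univ _, rfl⟩
        · rw [Finset.card_image_of_injective _ hs]; simp [hr]
      refine Finset.prod_bij (fun a _ => (x (s a.1), x (s a.2))) ?_ ?_ ?_ ?_
      · rintro ⟨a, b⟩ hab
        simp only [Finset.mem_offDiag, Finset.mem_univ, true_and] at hab
        simp only [Finset.mem_offDiag, ← himg, Finset.mem_image, Finset.mem_univ, true_and]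
        exact ⟨⟨a, rfl⟩, ⟨b, rfl⟩, fun h => hab (hs h)⟩
      · rintro ⟨a, b⟩ _ ⟨a', b'⟩ _ h
        simp only [Prod.mk.injEq] at h
        exact Prod.ext (hs h.1) (hs h.2)
      · rintro ⟨w, w'⟩ hw
        simp only [Finset.mem_offDiag, ← himg, Finset.mem_image, Finset.mem_univ, true_and] at hw
        obtain ⟨⟨a, rfl⟩, ⟨b, rfl⟩, hne⟩ := hw
        exact ⟨(a, b), by simpa using fun h : a = b => hne (by rw [h]), rfl⟩
      · intros; rfl
    · simp only [Function.Injective, not_forall] at hs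
      obtain ⟨a, b, he, hab⟩ := hs
      exact Finset.prod_eq_zero (i := (a, b)) (by simpa using hab) (sub_eq_zero.2 he)
  rw [aeval_tupleDisc, Finset.sum_congr rfl fun s _ => key s, ← Finset.sum_filter,
    Finset.sum_const, nsmul_eq_mul]
  refine mul_ne_zero (Nat.cast_ne_zero.2 (Finset.card_ne_zero.2 ?_)) ?_
  · have hex : ∀ a : Fin r, ∃ i : Fin d, x i = S.equivFin.symm a := fun a => by
      have := (S.equivFin.symm a).2
      obtain ⟨i, -, hi⟩ := Finset.mem_image.1 this
      exact ⟨i, hi⟩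
    choose s hs using hex
    refine ⟨s, Finset.mem_filter.2 ⟨Finset.mem_univ _, fun a b h => ?_⟩⟩
    simp only [Function.comp_apply, hs] at h
    exact S.equivFin.symm.injective (Subtype.ext h)
  · refine Finset.prod_ne_zero_iff.2 fun w hw => sub_ne_zero.2 (Finset.mem_offDiag.1 hw).2.2

theorem card_image_le_of_tupleDisc [CharZero K] {d : ℕ} (x y : Fin d → K)
    (h : ∀ r ≤ d, aeval y (tupleDisc d r) = 0 → aeval x (tupleDisc d r) = 0) :
    (Finset.univ.image x).card ≤ (Finset.univ.image y).card := by
  by_contra! hlt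
  refine aeval_tupleDisc_ne_zero x (h _ ?_ (aeval_tupleDisc_eq_zero y hlt))
  simpa using Finset.card_image_le (s := (Finset.univ : Finset (Fin d))) (f := x)

end

open Classical in
/-- The number of distinct complex roots of a real polynomial. -/
noncomputable def numRoots (p : Polynomial ℝ) : ℕ :=
  (p.map (algebraMap ℝ ℂ)).roots.toFinset.card

theorem exists_complex_factorization {d : ℕ} {p : Polynomial ℂ} (hp : p.natDegree = d) :
    ∃ x : Fin d → ℂ,
      p = Polynomial.C p.leadingCoeff * ∏ i, (Polynomial.X - Polynomial.C (x i)) := by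
  have hcard : p.roots.card = d := by
    rw [← hp]; exact Polynomial.splits_iff_card_roots.1 (IsAlgClosed.splits p)
  obtain ⟨l, hl⟩ := Quot.exists_rep p.roots
  have hll : l.length = d := by rw [← hcard, ← hl]; rfl
  subst hll
  refine ⟨l.get, ?_⟩
  conv_lhs => rw [← Polynomial.C_leadingCoeff_mul_prod_multiset_X_sub_C (hcard.trans hp.symm)]
  congr 1
  rw [← hl]
  change (Multiset.map _ (l : Multiset ℂ)).prod = _
  rw [Multiset.map_coe, Multiset.prod_coe, ← List.prod_ofFn]
  congr 1
  conv_lhs => rw [← List.ofFn_get l, List.map_ofFn]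
  rfl

theorem mem_roots_prod {d : ℕ} {c : ℂ} (hc : c ≠ 0) (x : Fin d → ℂ) (z : ℂ) :
    z ∈ (Polynomial.C c * ∏ i, (Polynomial.X - Polynomial.C (x i))).roots ↔ ∃ i, x i = z := by
  rw [Polynomial.mem_roots (mul_ne_zero (by simpa using hc)
    (Finset.prod_ne_zero_iff.2 fun i _ => Polynomial.X_sub_C_ne_zero _))]
  simp [Polynomial.IsRoot, Polynomial.eval_prod, Finset.prod_eq_zero_iff, hc, sub_eq_zero,
    @eq_comm _ z]

theorem numRoots_le_of_coeffDisc {d : ℕ} {p q : Polynomial ℝ} (hp : p.natDegree = d)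
    (hq : q.natDegree = d) (hp0 : p ≠ 0) (hq0 : q ≠ 0)
    (h : ∀ r ≤ d, coeffDisc d r q = 0 → coeffDisc d r p = 0) : numRoots p ≤ numRoots q := by
  classical
  have main : ∀ p : Polynomial ℝ, p.natDegree = d → p ≠ 0 → ∃ x : Fin d → ℂ,
      numRoots p = (Finset.univ.image x).card ∧
      ∀ r, coeffDisc d r p = 0 ↔ aeval x (tupleDisc d r) = 0 := by
    intro p hp hp0
    have hinj := (algebraMap ℝ ℂ).injective
    have hd : (p.map (algebraMap ℝ ℂ)).natDegree = d := by
      rw [Polynomial.natDegree_map_eq_of_injective hinj, hp]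
    obtain ⟨x, hx⟩ := exists_complex_factorization hd
    set c := (p.map (algebraMap ℝ ℂ)).leadingCoeff with hcdef
    have hc : c ≠ 0 := by
      rw [hcdef, Polynomial.leadingCoeff_ne_zero]
      exact (Polynomial.map_ne_zero_iff hinj).2 hp0
    refine ⟨fun i => c * x i, ?_, fun r => ?_⟩
    · have h1 : (p.map (algebraMap ℝ ℂ)).roots.toFinset = Finset.univ.image x := by
        ext z
        rw [Multiset.mem_toFinset, hx, mem_roots_prod hc]; simp
      have h2 : Finset.univ.image (fun i => c * x i) = (Finset.univ.image x).image (c * ·) := by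
        rw [Finset.image_image]; rfl
      rw [h2, Finset.card_image_of_injective _ (mul_right_injective₀ hc), ← h1, numRoots]
    · rw [← coeffDisc_prod, ← hx, ← map_coeffDisc, map_eq_zero]
  obtain ⟨x, hx, hx'⟩ := main p hp hp0
  obtain ⟨y, hy, hy'⟩ := main q hq hq0
  rw [hx, hy]
  exact card_image_le_of_tupleDisc x y fun r hr => by simpa only [← hx', ← hy'] using h r hr

theorem coeffDisc_comp_X_add_C {d r : ℕ} {p : Polynomial ℝ} (hp : p.natDegree = d) (s : ℝ) :
    coeffDisc d r (p.comp (Polynomial.X + Polynomial.C s)) = coeffDisc d r p := by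
  have hinj := (algebraMap ℝ ℂ).injective
  have hd : (p.map (algebraMap ℝ ℂ)).natDegree = d := by
    rw [Polynomial.natDegree_map_eq_of_injective hinj, hp]
  obtain ⟨x, hx⟩ := exists_complex_factorization hd
  set c := (p.map (algebraMap ℝ ℂ)).leadingCoeff
  apply hinj
  have h2 : (p.comp (Polynomial.X + Polynomial.C s)).map (algebraMap ℝ ℂ) =
      Polynomial.C c * ∏ i, (Polynomial.X - Polynomial.C (x i - s)) := by
    rw [Polynomial.map_comp, hx]
    simp only [Polynomial.mul_comp, Polynomial.C_comp, Polynomial.prod_comp, Polynomial.sub_comp,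
      Polynomial.X_comp, Polynomial.map_add, Polynomial.map_X, Polynomial.map_C, map_sub]
    congr 1
    refine Finset.prod_congr rfl fun i _ => ?_
    simp; ring
  rw [map_coeffDisc, map_coeffDisc, h2, hx, coeffDisc_prod, coeffDisc_prod, aeval_tupleDisc,
    aeval_tupleDisc]
  refine Finset.sum_congr rfl fun t _ => Finset.prod_congr rfl fun a _ => ?_
  ring

section PolynomialFamilies

open Filter Topology

/-- The distinct complex roots of a real polynomial. -/
noncomputable def complexRoots (p : Polynomial ℝ) : Finset ℂ :=
  open Classical in (p.map (algebraMap ℝ ℂ)).roots.toFinset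

/-- The distinct real roots of a real polynomial. -/
noncomputable def realRoots (p : Polynomial ℝ) : Finset ℝ := p.roots.toFinset

theorem card_complexRoots (p : Polynomial ℝ) : (complexRoots p).card = numRoots p := rfl

theorem mem_complexRoots {p : Polynomial ℝ} (hp : p ≠ 0) {z : ℂ} :
    z ∈ complexRoots p ↔ Polynomial.aeval z p = 0 := by
  classical
  rw [complexRoots, Multiset.mem_toFinset, Polynomial.mem_roots
    ((Polynomial.map_ne_zero_iff (algebraMap ℝ ℂ).injective).2 hp), Polynomial.IsRoot,
    Polynomial.eval_map_algebraMap]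

theorem mem_realRoots {p : Polynomial ℝ} (hp : p ≠ 0) {y : ℝ} :
    y ∈ realRoots p ↔ p.eval y = 0 := by
  rw [realRoots, Multiset.mem_toFinset, Polynomial.mem_roots hp, Polynomial.IsRoot]

theorem ofReal_mem_complexRoots {p : Polynomial ℝ} (hp : p ≠ 0) {y : ℝ} :
    (y : ℂ) ∈ complexRoots p ↔ y ∈ realRoots p := by
  rw [mem_complexRoots hp, mem_realRoots hp]
  have h : Polynomial.aeval (y : ℂ) p = ((p.eval y : ℝ) : ℂ) :=
    Polynomial.aeval_algebraMap_apply_eq_algebraMap_eval y p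
  rw [h, Complex.ofReal_eq_zero]

theorem conj_mem_complexRoots {p : Polynomial ℝ} (hp : p ≠ 0) {z : ℂ} (hz : z ∈ complexRoots p) :
    (starRingEnd ℂ) z ∈ complexRoots p := by
  rw [mem_complexRoots hp] at *
  rw [Polynomial.aeval_conj, hz, map_zero]

/-- A family of real polynomials with fixed degree, fixed nonzero leading coefficient, and
coefficients depending continuously on the parameter. -/
structure IsPolyFamily {U : Type*} [TopologicalSpace U] (f : U → Polynomial ℝ) (d : ℕ) (c : ℝ) :
    Prop where
  natDegree_eq : ∀ u, (f u).natDegree = d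
  leadingCoeff_eq : ∀ u, (f u).leadingCoeff = c
  ne_zero : c ≠ 0
  continuous_coeff : ∀ i, Continuous fun u => (f u).coeff i

variable {U : Type*} [TopologicalSpace U] {f g : U → Polynomial ℝ} {d e : ℕ} {c c' : ℝ}

namespace IsPolyFamily

theorem apply_ne_zero (hf : IsPolyFamily f d c) (u : U) : f u ≠ 0 := by
  rw [← Polynomial.leadingCoeff_ne_zero, hf.leadingCoeff_eq]; exact hf.ne_zero

theorem continuous_eval (hf : IsPolyFamily f d c) {η : U → ℝ} (hη : Continuous η) :
    Continuous fun u => (f u).eval (η u) := by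
  have h : (fun u => (f u).eval (η u)) =
      fun u => ∑ i ∈ Finset.range (d + 1), (f u).coeff i * η u ^ i := by
    ext u
    rw [Polynomial.eval_eq_sum_range' (n := d + 1) (by rw [hf.natDegree_eq]; omega)]
  rw [h]
  exact continuous_finsetSum _ fun i _ => (hf.continuous_coeff i).mul (hη.pow i)

theorem continuous_aeval (hf : IsPolyFamily f d c) (w : ℂ) :
    Continuous fun u => Polynomial.aeval w (f u) := by
  have h : (fun u => Polynomial.aeval w (f u)) =
      fun u => ∑ i ∈ Finset.range (d + 1), (f u).coeff i • w ^ i := by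
    ext u
    rw [Polynomial.aeval_eq_sum_range' (n := d + 1) (by rw [hf.natDegree_eq]; omega)]
  rw [h]
  exact continuous_finsetSum _ fun i _ => (hf.continuous_coeff i).smul continuous_const

theorem eventually_exists_root (hf : IsPolyFamily f d c) {u₀ : U} {w : ℂ}
    (hw : w ∈ complexRoots (f u₀)) {ε : ℝ} (hε : 0 < ε) :
    ∀ᶠ u in 𝓝 u₀, ∃ z ∈ complexRoots (f u), ‖z - w‖ < ε := by
  have hlim : Tendsto (fun u => ‖Polynomial.aeval w (f u)‖) (𝓝 u₀) (𝓝 0) := by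
    have h := (hf.continuous_aeval w).norm.tendsto u₀
    rwa [(mem_complexRoots (hf.apply_ne_zero _)).1 hw, norm_zero] at h
  have hpos : 0 < |c| * ε ^ d := mul_pos (abs_pos.2 hf.ne_zero) (pow_pos hε d)
  filter_upwards [hlim.eventually (gt_mem_nhds hpos)] with u hu
  by_contra! hcon
  refine absurd hu (not_lt.2 ?_)
  have hinj := (algebraMap ℝ ℂ).injective
  obtain ⟨x, hx⟩ := exists_complex_factorization (p := (f u).map (algebraMap ℝ ℂ)) (d := d)
    (by rw [Polynomial.natDegree_map_eq_of_injective hinj, hf.natDegree_eq])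
  have hlc : ((f u).map (algebraMap ℝ ℂ)).leadingCoeff = (c : ℂ) := by
    rw [Polynomial.leadingCoeff_map_of_injective hinj, hf.leadingCoeff_eq]; rfl
  rw [hlc] at hx
  have hroot : ∀ i, x i ∈ complexRoots (f u) := fun i => by
    classical
    rw [complexRoots, Multiset.mem_toFinset, hx,
      mem_roots_prod (Complex.ofReal_ne_zero.2 hf.ne_zero)]
    exact ⟨i, rfl⟩
  rw [← Polynomial.eval_map_algebraMap, hx]
  simp only [Polynomial.eval_mul, Polynomial.eval_C, Polynomial.eval_prod, Polynomial.eval_sub,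
    Polynomial.eval_X, norm_mul, norm_prod, Complex.norm_real, Real.norm_eq_abs]
  gcongr
  calc ε ^ d = ∏ _i : Fin d, ε := by simp
    _ ≤ _ := Finset.prod_le_prod (fun _ _ => hε.le) fun i _ => by
      rw [norm_sub_rev]; exact hcon _ (hroot i)

end IsPolyFamily

theorem exists_separation (S : Finset ℂ) : ∃ ε > 0,
    (∀ w ∈ S, ∀ w' ∈ S, ‖w - w'‖ < 2 * ε → w = w') ∧ ∀ w ∈ S, |w.im| < ε → w.im = 0 := by
  have h1 : ∀ᶠ ε : ℝ in 𝓝[>] 0, ∀ p ∈ S ×ˢ S, ‖p.1 - p.2‖ < 2 * ε → p.1 = p.2 := by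
    rw [eventually_all_finset]
    intro p _
    by_cases hp : p.1 = p.2
    · exact Eventually.of_forall fun _ _ => hp
    · have hpos : 0 < ‖p.1 - p.2‖ / 2 := half_pos (norm_pos_iff.2 (sub_ne_zero.2 hp))
      filter_upwards [nhdsWithin_le_nhds (gt_mem_nhds hpos)] with ε hε h
      linarith
  have h2 : ∀ᶠ ε : ℝ in 𝓝[>] 0, ∀ w ∈ S, |w.im| < ε → w.im = 0 := by
    rw [eventually_all_finset]
    intro w _
    by_cases hw : w.im = 0
    · exact Eventually.of_forall fun _ _ => hw
    · filter_upwards [nhdsWithin_le_nhds (gt_mem_nhds (abs_pos.2 hw))] with ε hε h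
      linarith
  obtain ⟨ε, ⟨h1, h2⟩, hε⟩ := ((h1.and h2).and self_mem_nhdsWithin).exists
  exact ⟨ε, hε, fun w hw w' hw' => h1 (w, w') (Finset.mk_mem_product hw hw'), h2⟩

namespace IsPolyFamily

/-- If the number of distinct complex roots is constant, then near `u₀` each real root moves
to a unique nearby real root, and all real roots arise in this way. -/
theorem exists_root_map (hf : IsPolyFamily f d c) (hN : ∀ u u', numRoots (f u) = numRoots (f u'))
    (u₀ : U) : ∃ ε₀ > 0, ∀ ε, 0 < ε → ε ≤ ε₀ → ∀ᶠ u in 𝓝 u₀, ∃ m : ℝ → ℝ,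
      (∀ w ∈ realRoots (f u₀), m w ∈ realRoots (f u) ∧ |m w - w| < ε) ∧
      (∀ y ∈ realRoots (f u), ∃ w ∈ realRoots (f u₀), m w = y) ∧
      (∀ w ∈ realRoots (f u₀), ∀ z ∈ complexRoots (f u), ‖z - w‖ < ε → z = m w) ∧
      ∀ w ∈ realRoots (f u₀), ∀ w' ∈ realRoots (f u₀), w < w' → m w < m w' := by
  obtain ⟨ε₀, hε₀, hsep, him⟩ := exists_separation (complexRoots (f u₀))
  refine ⟨ε₀, hε₀, fun ε hε hle => ?_⟩
  have hev : ∀ᶠ u in 𝓝 u₀, ∀ w ∈ complexRoots (f u₀), ∃ z ∈ complexRoots (f u), ‖z - w‖ < ε := by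
    rw [eventually_all_finset]
    exact fun w hw => hf.eventually_exists_root hw hε
  filter_upwards [hev] with u hu
  have hchoose : ∃ M : ℂ → ℂ, ∀ w ∈ complexRoots (f u₀), M w ∈ complexRoots (f u) ∧
      ‖M w - w‖ < ε := by
    choose! M hM using hu
    exact ⟨M, hM⟩
  obtain ⟨M, hM⟩ := hchoose
  have hnear : ∀ w ∈ complexRoots (f u₀), ∀ w' ∈ complexRoots (f u₀), ∀ z : ℂ,
      ‖z - w‖ < ε → ‖z - w'‖ < ε → w = w' := by
    intro w hw w' hw' z h h'
    refine hsep w hw w' hw' ?_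
    have : ‖w - w'‖ ≤ ‖w - z‖ + ‖z - w'‖ := norm_sub_le_norm_sub_add_norm_sub w z w'
    rw [norm_sub_rev w z] at this
    linarith
  have hinj : Set.InjOn M (complexRoots (f u₀)) := fun w hw w' hw' h =>
    hnear w hw w' hw' (M w) (hM w hw).2 (h ▸ (hM w' hw').2)
  have himg : (complexRoots (f u₀)).image M = complexRoots (f u) := by
    apply Finset.eq_of_subset_of_card_le
    · intro z hz
      obtain ⟨w, hw, rfl⟩ := Finset.mem_image.1 hz
      exact (hM w hw).1
    · rw [Finset.card_image_of_injOn hinj, card_complexRoots, card_complexRoots, hN u u₀]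
  have huniq : ∀ w ∈ complexRoots (f u₀), ∀ z ∈ complexRoots (f u), ‖z - w‖ < ε → z = M w := by
    intro w hw z hz h
    rw [← himg] at hz
    obtain ⟨w', hw', rfl⟩ := Finset.mem_image.1 hz
    rw [hnear w hw w' hw' _ h (hM w' hw').2]
  have hre : ∀ w ∈ realRoots (f u₀), (((M w).re : ℝ) : ℂ) = M w := by
    intro w hw
    have hwc := (ofReal_mem_complexRoots (hf.apply_ne_zero u₀)).2 hw
    refine Complex.conj_eq_iff_re.1 (huniq w hwc _
      (conj_mem_complexRoots (hf.apply_ne_zero u) (hM w hwc).1) ?_)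
    calc ‖(starRingEnd ℂ) (M w) - w‖ = ‖(starRingEnd ℂ) (M w - w)‖ := by simp
      _ = ‖M w - w‖ := RCLike.norm_conj _
      _ < ε := (hM w hwc).2
  have hmem : ∀ w ∈ realRoots (f u₀), (M w).re ∈ realRoots (f u) ∧ |(M w).re - w| < ε := by
    intro w hw
    have hwc := (ofReal_mem_complexRoots (hf.apply_ne_zero u₀)).2 hw
    obtain ⟨h1, h2⟩ := hM w hwc
    refine ⟨by rwa [← hre w hw, ofReal_mem_complexRoots (hf.apply_ne_zero u)] at h1, ?_⟩
    rwa [← hre w hw, ← Complex.ofReal_sub, Complex.norm_real] at h2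
  refine ⟨fun w => (M w).re, hmem, ?_, ?_, ?_⟩
  · intro y hy
    have hyc := (ofReal_mem_complexRoots (hf.apply_ne_zero u)).2 hy
    rw [← himg] at hyc
    obtain ⟨w, hw, hwy⟩ := Finset.mem_image.1 hyc
    have hw0 : w.im = 0 := by
      refine him w hw (lt_of_lt_of_le ?_ hle)
      have h := (Complex.abs_im_le_norm (M w - w)).trans_lt (hM w hw).2
      rwa [hwy, Complex.sub_im, Complex.ofReal_im, zero_sub, abs_neg] at h
    have hwre : ((w.re : ℝ) : ℂ) = w := Complex.ext (by simp) (by simp [hw0])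
    refine ⟨w.re, (ofReal_mem_complexRoots (hf.apply_ne_zero u₀)).1 (by rwa [hwre]), ?_⟩
    simp [hwre, hwy]
  · intro w hw z hz h
    rw [hre w hw]
    exact huniq w ((ofReal_mem_complexRoots (hf.apply_ne_zero u₀)).2 hw) z hz h
  · intro w hw w' hw' hlt
    have h1 := abs_lt.1 (hmem w hw).2
    have h2 := abs_lt.1 (hmem w' hw').2
    have h3 : 2 * ε₀ ≤ w' - w := by
      by_contra! hcon
      refine hlt.ne' (Complex.ofReal_injective
        (hsep w' ((ofReal_mem_complexRoots (hf.apply_ne_zero u₀)).2 hw') w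
        ((ofReal_mem_complexRoots (hf.apply_ne_zero u₀)).2 hw) ?_))
      rwa [← Complex.ofReal_sub, Complex.norm_real, Real.norm_eq_abs,
        abs_of_pos (sub_pos.2 hlt)]
    dsimp only
    linarith

theorem card_realRoots_eq [PreconnectedSpace U] (hf : IsPolyFamily f d c)
    (hN : ∀ u u', numRoots (f u) = numRoots (f u')) (u u' : U) :
    (realRoots (f u)).card = (realRoots (f u')).card := by
  have hloc : IsLocallyConstant fun u => (realRoots (f u)).card := by
    refine (IsLocallyConstant.iff_eventually_eq _).2 fun u₀ => ?_
    obtain ⟨ε, hε, h⟩ := hf.exists_root_map hN u₀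
    filter_upwards [h ε hε le_rfl] with u ⟨m, h1, h2, _, h4⟩
    symm
    refine Finset.card_bij (fun w _ => m w) (fun w hw => (h1 w hw).1) ?_ ?_
    · intro w hw w' hw' he
      rcases lt_trichotomy w w' with hlt | heq | hlt
      · exact absurd he (h4 w hw w' hw' hlt).ne
      · exact heq
      · exact absurd he (h4 w' hw' w hw hlt).ne'
    · intro y hy
      obtain ⟨w, hw, hwy⟩ := h2 y hy
      exact ⟨w, hw, hwy⟩
  exact hloc.apply_eq_of_preconnectedSpace u u'

theorem continuous_orderEmbOfFin (hf : IsPolyFamily f d c)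
    (hN : ∀ u u', numRoots (f u) = numRoots (f u')) {k : ℕ}
    (hk : ∀ u, (realRoots (f u)).card = k) (r : Fin k) :
    Continuous fun u => (realRoots (f u)).orderEmbOfFin (hk u) r := by
  refine continuous_iff_continuousAt.2 fun u₀ => Metric.tendsto_nhds.2 fun ε hε => ?_
  obtain ⟨ε₀, hε₀, h⟩ := hf.exists_root_map hN u₀
  filter_upwards [h (min ε ε₀) (lt_min hε hε₀) (min_le_right _ _)] with u ⟨m, h1, _, _, h4⟩
  have hmem := fun s => Finset.orderEmbOfFin_mem (realRoots (f u₀)) (hk u₀) s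
  have heq : (fun s => m ((realRoots (f u₀)).orderEmbOfFin (hk u₀) s)) =
      (realRoots (f u)).orderEmbOfFin (hk u) :=
    Finset.orderEmbOfFin_unique (hk u) (fun s => (h1 _ (hmem s)).1)
      fun s t hst => h4 _ (hmem s) _ (hmem t) (OrderEmbedding.strictMono _ hst)
  rw [← congrFun heq r, Real.dist_eq]
  exact (h1 _ (hmem r)).2.trans_le (min_le_left _ _)

/-- A factor of the family vanishes either everywhere or nowhere along a continuous root. -/
theorem factor_eval_eq_zero_iff [PreconnectedSpace U] (hf : IsPolyFamily f d c)
    (hN : ∀ u u', numRoots (f u) = numRoots (f u')) (hg : IsPolyFamily g e c')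
    (hgf : ∀ u, g u ∣ f u) {η : U → ℝ} (hη : Continuous η) (hroot : ∀ u, (f u).eval (η u) = 0)
    (u u' : U) : (g u).eval (η u) = 0 ↔ (g u').eval (η u') = 0 := by
  have hclosed : IsClosed {u | (g u).eval (η u) = 0} :=
    isClosed_eq (hg.continuous_eval hη) continuous_const
  have hopen : IsOpen {u | (g u).eval (η u) = 0} := by
    rw [isOpen_iff_mem_nhds]
    intro u₀ hu₀
    obtain ⟨ε, hε, h⟩ := hf.exists_root_map hN u₀
    have hg₀ : (η u₀ : ℂ) ∈ complexRoots (g u₀) :=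
      (ofReal_mem_complexRoots (hg.apply_ne_zero u₀)).2
        ((mem_realRoots (hg.apply_ne_zero u₀)).2 hu₀)
    have hcont := Metric.tendsto_nhds.1 (hη.tendsto u₀) ε hε
    filter_upwards [h ε hε le_rfl, hg.eventually_exists_root hg₀ hε, hcont]
      with u ⟨m, _, _, h3, _⟩ ⟨z, hz, hzw⟩ hd
    have hη₀ : η u₀ ∈ realRoots (f u₀) := (mem_realRoots (hf.apply_ne_zero u₀)).2 (hroot u₀)
    have hzf : z ∈ complexRoots (f u) := by
      rw [mem_complexRoots (hf.apply_ne_zero u)]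
      rw [mem_complexRoots (hg.apply_ne_zero u)] at hz
      obtain ⟨q, hq⟩ := hgf u
      rw [hq, map_mul, hz, zero_mul]
    have hηf : (η u : ℂ) ∈ complexRoots (f u) :=
      (ofReal_mem_complexRoots (hf.apply_ne_zero u)).2
        ((mem_realRoots (hf.apply_ne_zero u)).2 (hroot u))
    have hzη : z = η u := by
      rw [h3 _ hη₀ z hzf hzw, h3 _ hη₀ (η u) hηf]
      rwa [← Complex.ofReal_sub, Complex.norm_real, ← dist_eq_norm]
    rw [hzη, ofReal_mem_complexRoots (hg.apply_ne_zero u), mem_realRoots (hg.apply_ne_zero u)] at hz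
    exact hz
  rcases isClopen_iff.1 ⟨hclosed, hopen⟩ with h | h
  · have : ∀ u, ¬ (g u).eval (η u) = 0 := fun u hu => by
      have : u ∈ ({u | (g u).eval (η u) = 0} : Set U) := hu
      rw [h] at this; exact this
    simp [this]
  · have : ∀ u, (g u).eval (η u) = 0 := fun u => by
      have : u ∈ ({u | (g u).eval (η u) = 0} : Set U) := by rw [h]; trivial
      exact this
    simp [this]

theorem exists_bound_realRoots (hf : IsPolyFamily f d c)
    (hb : ∀ i, ∃ B, ∀ u, |(f u).coeff i| ≤ B) : ∃ B, ∀ u, ∀ y ∈ realRoots (f u), |y| ≤ B := by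
  choose B hB using hb
  refine ⟨(∑ i ∈ Finset.range d, |B i|) / |c| + 1, fun u y hy => ?_⟩
  have hc := abs_pos.2 hf.ne_zero
  have hroot := (mem_realRoots (hf.apply_ne_zero u)).1 hy
  have hlt := Polynomial.IsRoot.norm_lt_cauchyBound (hf.apply_ne_zero u) hroot
  refine (NNReal.coe_lt_coe.2 hlt).le.trans ?_
  rw [Polynomial.cauchyBound, hf.natDegree_eq, hf.leadingCoeff_eq]
  push_cast
  rw [Real.norm_eq_abs]
  gcongr
  have hsup : (Finset.range d).sup (fun i => ‖(f u).coeff i‖₊) ≤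
      ∑ i ∈ Finset.range d, ‖(f u).coeff i‖₊ :=
    Finset.sup_le fun i hi => Finset.single_le_sum (f := fun i => ‖(f u).coeff i‖₊)
      (fun _ _ => zero_le) hi
  calc (((Finset.range d).sup fun i => ‖(f u).coeff i‖₊ : NNReal) : ℝ)
      ≤ ((∑ i ∈ Finset.range d, ‖(f u).coeff i‖₊ : NNReal) : ℝ) := NNReal.coe_le_coe.2 hsup
    _ = ∑ i ∈ Finset.range d, |(f u).coeff i| := by push_cast; simp
    _ ≤ ∑ i ∈ Finset.range d, |B i| := Finset.sum_le_sum fun i _ => (hB i u).trans (le_abs_self _)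

/-- Through every point over `u₀` passes a continuous section that avoids the real roots or
consists of real roots, and which is bounded if the coefficients are. -/
theorem exists_section [PreconnectedSpace U] (hf : IsPolyFamily f d c)
    (hN : ∀ u u', numRoots (f u) = numRoots (f u')) (u₀ : U) (y₀ : ℝ) :
    ∃ η : U → ℝ, Continuous η ∧ η u₀ = y₀ ∧
      ((∀ u, (f u).eval (η u) = 0) ∨ ∀ u, (f u).eval (η u) ≠ 0) ∧
      ((∀ i, ∃ B, ∀ u, |(f u).coeff i| ≤ B) → ∃ B, ∀ u, |η u| ≤ B) := by
  obtain ⟨k, hk⟩ : ∃ k, ∀ u, (realRoots (f u)).card = k :=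
    ⟨_, fun u => hf.card_realRoots_eq hN u u₀⟩
  set ρ : Fin k → U → ℝ := fun r u => (realRoots (f u)).orderEmbOfFin (hk u) r with hρ
  have hρc : ∀ r, Continuous (ρ r) := fun r => hf.continuous_orderEmbOfFin hN hk r
  have hρmem : ∀ r u, ρ r u ∈ realRoots (f u) := fun r u => Finset.orderEmbOfFin_mem _ _ _
  have hρmono : ∀ {r s} u, r ≤ s → ρ r u ≤ ρ s u := fun {r s} u h =>
    ((realRoots (f u)).orderEmbOfFin (hk u)).monotone h
  have hρstrict : ∀ {r s} u, ρ r u < ρ s u ↔ r < s := fun {r s} u =>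
    ((realRoots (f u)).orderEmbOfFin (hk u)).lt_iff_lt
  have hρsurj : ∀ u y, (f u).eval y = 0 → ∃ r, ρ r u = y := fun u y hy => by
    have h := Finset.range_orderEmbOfFin (realRoots (f u)) (hk u)
    have hy' : y ∈ (realRoots (f u) : Set ℝ) := (mem_realRoots (hf.apply_ne_zero u)).2 hy
    rw [← h] at hy'
    exact hy'
  have hρb : (∀ i, ∃ B, ∀ u, |(f u).coeff i| ≤ B) → ∃ B, ∀ r u, |ρ r u| ≤ B := fun hb => by
    obtain ⟨B, hB⟩ := hf.exists_bound_realRoots hb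
    exact ⟨B, fun r u => hB u _ (hρmem r u)⟩
  by_cases hy : ∃ r, ρ r u₀ = y₀
  · obtain ⟨r, hr⟩ := hy
    refine ⟨ρ r, hρc r, hr, Or.inl fun u => (mem_realRoots (hf.apply_ne_zero u)).1 (hρmem r u),
      fun hb => ?_⟩
    obtain ⟨B, hB⟩ := hρb hb
    exact ⟨B, hB r⟩
  push Not at hy
  have hlow : (∀ r, y₀ < ρ r u₀) ∨ ∃ l, ρ l u₀ < y₀ ∧ ∀ r, ρ r u₀ < y₀ → r ≤ l := by
    by_cases hne : (Finset.univ.filter fun r => ρ r u₀ < y₀).Nonempty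
    · right
      have hmax := Finset.max'_mem _ hne
      refine ⟨Finset.max' _ hne, (Finset.mem_filter.1 hmax).2, fun r hr => Finset.le_max' _ _ ?_⟩
      simpa using hr
    · left
      intro r
      by_contra hcon
      exact hne ⟨r, by simpa using lt_of_le_of_ne (not_lt.1 hcon) (hy r)⟩
  have hhigh : (∀ r, ρ r u₀ < y₀) ∨ ∃ h, y₀ < ρ h u₀ ∧ ∀ r, y₀ < ρ r u₀ → h ≤ r := by
    by_cases hne : (Finset.univ.filter fun r => y₀ < ρ r u₀).Nonempty
    · right
      have hmin := Finset.min'_mem _ hne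
      refine ⟨Finset.min' _ hne, (Finset.mem_filter.1 hmin).2, fun r hr => Finset.min'_le _ _ ?_⟩
      simpa using hr
    · left
      intro r
      by_contra hcon
      exact hne ⟨r, by simpa using lt_of_le_of_ne (not_lt.1 hcon) (hy r).symm⟩
  rcases hlow with hlow | ⟨l, hl, hlmax⟩ <;> rcases hhigh with hhigh | ⟨h, hh, hhmin⟩
  · refine ⟨fun _ => y₀, continuous_const, rfl, Or.inr fun u hu => ?_,
      fun _ => ⟨|y₀|, fun _ => le_rfl⟩⟩
    obtain ⟨r, -⟩ := hρsurj u _ hu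
    exact lt_asymm (hlow r) (hhigh r)
  · refine ⟨fun u => ρ h u - (ρ h u₀ - y₀), (hρc h).sub continuous_const, by ring,
      Or.inr fun u hu => ?_, fun hb => ?_⟩
    · obtain ⟨r, hr⟩ := hρsurj u _ hu
      have := hρmono u (hhmin r (hlow r))
      linarith
    · obtain ⟨B, hB⟩ := hρb hb
      exact ⟨B + |ρ h u₀ - y₀|, fun u => (abs_sub _ _).trans (add_le_add (hB h u) le_rfl)⟩
  · refine ⟨fun u => ρ l u - (ρ l u₀ - y₀), (hρc l).sub continuous_const, by ring,
      Or.inr fun u hu => ?_, fun hb => ?_⟩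
    · obtain ⟨r, hr⟩ := hρsurj u _ hu
      have := hρmono u (hlmax r (hhigh r))
      linarith
    · obtain ⟨B, hB⟩ := hρb hb
      exact ⟨B + |ρ l u₀ - y₀|, fun u => (abs_sub _ _).trans (add_le_add (hB l u) le_rfl)⟩
  · have hgap : 0 < ρ h u₀ - ρ l u₀ := by linarith
    set t := (y₀ - ρ l u₀) / (ρ h u₀ - ρ l u₀) with ht
    have ht0 : 0 < t := div_pos (by linarith) hgap
    have ht1 : t < 1 := (div_lt_one hgap).2 (by linarith)
    refine ⟨fun u => ρ l u + t * (ρ h u - ρ l u),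
      (hρc l).add (continuous_const.mul ((hρc h).sub (hρc l))), ?_, Or.inr fun u hu => ?_,
      fun hb => ?_⟩
    · simp only [ht]; field_simp; ring
    · obtain ⟨r, hr⟩ := hρsurj u _ hu
      have hlh : ρ l u < ρ h u := (hρstrict u).2 ((hρstrict u₀).1 (hl.trans hh))
      rcases lt_or_gt_of_ne (hy r) with hr' | hr'
      · have := hρmono u (hlmax r hr')
        nlinarith
      · have := hρmono u (hhmin r hr')
        nlinarith
    · obtain ⟨B, hB⟩ := hρb hb
      refine ⟨B + |t| * (B + B), fun u => (abs_add_le _ _).trans (add_le_add (hB l u) ?_)⟩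
      rw [abs_mul]
      gcongr
      exact (abs_sub _ _).trans (add_le_add (hB h u) (hB l u))

end IsPolyFamily

end PolynomialFamilies

section Line

variable {n : ℕ} {R S : Type*} [CommRing R] [CommRing S]

/-- The restriction of `F` to the line through `z` with direction `v`. -/
noncomputable def line (v z : Fin n → R) : MvPolynomial (Fin n) R →ₐ[R] Polynomial R :=
  aeval fun i => Polynomial.C (z i) + Polynomial.C (v i) * Polynomial.X

theorem map_line (φ : R →+* S) (v z : Fin n → R) (F : MvPolynomial (Fin n) R) :
    (line v z F).map φ = line (φ ∘ v) (φ ∘ z) (map φ F) := by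
  induction F using MvPolynomial.induction_on with
  | C a => simp [line]
  | add p q hp hq => simp only [map_add, Polynomial.map_add, hp, hq]
  | mul_X p i hp => simp only [map_mul, Polynomial.map_mul, hp]; simp [line]

theorem eval_line (v z : Fin n → R) (F : MvPolynomial (Fin n) R) (t : R) :
    (line v z F).eval t = eval (z + t • v) F := by
  induction F using MvPolynomial.induction_on with
  | C a => simp [line]
  | add p q hp hq => simp only [map_add, Polynomial.eval_add, hp, hq]
  | mul_X p i hp => simp only [map_mul, Polynomial.eval_mul, hp]; simp [line]; ring

theorem coeff_prod_sum_of_natDegree_le {ι : Type*} (t : Finset ι) (p : ι → Polynomial R)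
    (e : ι → ℕ) (h : ∀ i ∈ t, (p i).natDegree ≤ e i) :
    (∏ i ∈ t, p i).coeff (∑ i ∈ t, e i) = ∏ i ∈ t, (p i).coeff (e i) := by
  classical
  induction t using Finset.induction_on with
  | empty => simp
  | insert i t hi ih =>
    have ht : ∀ j ∈ t, (p j).natDegree ≤ e j := fun j hj => h j (Finset.mem_insert_of_mem hj)
    rw [Finset.prod_insert hi, Finset.sum_insert hi, Finset.prod_insert hi, ← ih ht]
    exact Polynomial.coeff_mul_add_eq_of_natDegree_le (h i (Finset.mem_insert_self i t))
      ((Polynomial.natDegree_prod_le _ _).trans (Finset.sum_le_sum ht))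

theorem natDegree_line_monomial_le (v z : Fin n → R) (s : Fin n →₀ ℕ) (a : R) :
    (line v z (monomial s a)).natDegree ≤ s.degree ∧
      (line v z (monomial s a)).coeff s.degree = eval v (monomial s a) := by
  have hlin : ∀ i, (Polynomial.C (z i) + Polynomial.C (v i) * Polynomial.X).natDegree ≤ 1 :=
    fun i => by compute_degree
  have hpow : ∀ i, ((Polynomial.C (z i) + Polynomial.C (v i) * Polynomial.X) ^ s i).natDegree ≤
      s i := fun i => by simpa using Polynomial.natDegree_pow_le_of_le (s i) (hlin i)
  have hE : line v z (monomial s a) = Polynomial.C a *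
      ∏ i, (Polynomial.C (z i) + Polynomial.C (v i) * Polynomial.X) ^ s i := by
    rw [line, aeval_monomial, Finsupp.prod_fintype _ _ (by simp)]; rfl
  have hdeg : s.degree = ∑ i, s i := Finsupp.degree_eq_sum s
  rw [hE, hdeg]
  constructor
  · refine (Polynomial.natDegree_C_mul_le _ _).trans ((Polynomial.natDegree_prod_le _ _).trans ?_)
    exact Finset.sum_le_sum fun i _ => hpow i
  · rw [Polynomial.coeff_C_mul, coeff_prod_sum_of_natDegree_le _ _ _ fun i _ => hpow i,
      eval_monomial, Finsupp.prod_fintype _ _ (by simp)]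
    congr 1
    refine Finset.prod_congr rfl fun i _ => ?_
    have h := Polynomial.coeff_pow_of_natDegree_le (m := s i) (hlin i)
    simpa using h

theorem natDegree_line_le (v z : Fin n → R) {F : MvPolynomial (Fin n) R} {d : ℕ}
    (hd : F.totalDegree ≤ d) : (line v z F).natDegree ≤ d := by
  rw [F.as_sum, map_sum]
  refine Polynomial.natDegree_sum_le_of_forall_le _ _ fun s hs => ?_
  refine (natDegree_line_monomial_le v z s _).1.trans ((le_totalDegree hs).trans' ?_ |>.trans hd)
  simp [Finsupp.degree_eq_sum, Finsupp.sum_fintype]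

theorem coeff_line (v z : Fin n → R) {F : MvPolynomial (Fin n) R} {d : ℕ}
    (hd : F.totalDegree ≤ d) :
    (line v z F).coeff d = eval v (homogeneousComponent d F) := by
  rw [homogeneousComponent_apply, map_sum, Finset.sum_filter]
  conv_lhs => rw [F.as_sum, map_sum, Polynomial.finsetSum_coeff]
  refine Finset.sum_congr rfl fun s hs => ?_
  obtain ⟨h1, h2⟩ := natDegree_line_monomial_le v z s (coeff s F)
  split_ifs with h
  · rw [← h, h2]
  · have hle : s.degree ≤ d := by
      refine le_trans ?_ ((le_totalDegree hs).trans hd)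
      simp [Finsupp.degree_eq_sum, Finsupp.sum_fintype]
    exact Polynomial.coeff_eq_zero_of_natDegree_lt (h1.trans_lt (lt_of_le_of_ne hle h))

theorem homogeneousComponent_totalDegree_ne_zero {F : MvPolynomial (Fin n) R} (hF : F ≠ 0) :
    homogeneousComponent F.totalDegree F ≠ 0 := by
  obtain ⟨s, hs, hsd⟩ := Finset.exists_mem_eq_sup F.support (support_nonempty.2 hF)
    fun s => s.sum fun _ e => e
  intro h0
  have h := congrArg (coeff s) h0
  rw [coeff_homogeneousComponent, coeff_zero, if_pos] at h
  · exact mem_support_iff.1 hs h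
  · rw [totalDegree, hsd]; simp [Finsupp.degree_eq_sum, Finsupp.sum_fintype]

/-- The restriction of `F` to the line with direction `v` through the generic point. -/
noncomputable def genericLine (v : Fin n → R) :
    MvPolynomial (Fin n) R →+* Polynomial (MvPolynomial (Fin n) R) :=
  (line (fun i => C (v i)) X).toRingHom.comp (map C)

theorem map_genericLine (v z : Fin n → R) (F : MvPolynomial (Fin n) R) :
    (genericLine v F).map (eval z) = line v z F := by
  have h : (eval z).comp C = RingHom.id R := by ext; simp
  change (line (fun i => C (v i)) X (map C F)).map (eval z) = _
  rw [map_line, map_map, h, map_id]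
  congr 2
  · ext; simp
  · ext; simp

end Line

section Projection

variable {n : ℕ}

/-- `F'` is a projection of `F` along `v`: on the lines with direction `v` the leading coefficient
of `F` is constant and the number of complex roots of `F` is determined by the vanishing of the
divisors of `F'`, and `F'` inherits the translation invariances of `F`. -/
structure IsProjection (F : MvPolynomial (Fin n) ℝ) (v : Fin n → ℝ)
    (F' : MvPolynomial (Fin n) ℝ) : Prop where
  isUnit : IsUnit (genericLine v F).leadingCoeff
  numRoots_eq : ∀ z z', (∀ g, g ∣ F' → (eval z g = 0 ↔ eval z' g = 0)) →
    numRoots (line v z F) = numRoots (line v z' F)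
  eval_add_smul : ∀ z (s : ℝ), eval (z + s • v) F' = eval z F'
  eval_add : ∀ w, (∀ z, eval (z + w) F = eval z F) → ∀ z, eval (z + w) F' = eval z F'

theorem isPolyFamily_line {U : Type*} [TopologicalSpace U] {F : MvPolynomial (Fin n) ℝ}
    {v : Fin n → ℝ} (h : IsUnit (genericLine v F).leadingCoeff) : ∃ d c,
    ∀ σ : U → Fin n → ℝ, Continuous σ → IsPolyFamily (fun u => line v (σ u) F) d c := by
  obtain ⟨c, hc, hlc⟩ := isUnit_iff_eq_C_of_isReduced.1 h
  refine ⟨(genericLine v F).natDegree, c, fun σ hσ => ⟨fun u => ?_, fun u => ?_, hc.ne_zero,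
    fun i => ?_⟩⟩
  · rw [← map_genericLine, Polynomial.natDegree_map_of_leadingCoeff_ne_zero]
    rw [hlc]; simpa using hc.ne_zero
  · rw [← map_genericLine, Polynomial.leadingCoeff_map_of_leadingCoeff_ne_zero] <;> rw [hlc]
    · simp
    · simpa using hc.ne_zero
  · simp only [← map_genericLine, Polynomial.coeff_map]
    exact (MvPolynomial.continuous_eval _).comp hσ

theorem isUnit_leadingCoeff_of_dvd {F g : MvPolynomial (Fin n) ℝ} {v : Fin n → ℝ}
    (h : IsUnit (genericLine v F).leadingCoeff) (hg : g ∣ F) :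
    IsUnit (genericLine v g).leadingCoeff := by
  obtain ⟨k, rfl⟩ := hg
  rw [map_mul, Polynomial.leadingCoeff_mul] at h
  exact isUnit_of_mul_isUnit_left h

theorem line_add_smul (F : MvPolynomial (Fin n) ℝ) (v z : Fin n → ℝ) (s : ℝ) :
    line v (z + s • v) F = (line v z F).comp (Polynomial.X + Polynomial.C s) := by
  refine Polynomial.funext fun t => ?_
  rw [Polynomial.eval_comp, eval_line, eval_line]
  congr 2
  simp only [Polynomial.eval_add, Polynomial.eval_X, Polynomial.eval_C, add_smul]
  abel

theorem totalDegree_map_le {R S : Type*} [CommRing R] [CommRing S] (φ : R →+* S)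
    (F : MvPolynomial (Fin n) R) : (map φ F).totalDegree ≤ F.totalDegree :=
  Finset.sup_mono (support_map_subset φ F)

theorem coeff_line_generic {A : Type*} [CommRing A] (F : MvPolynomial (Fin n) A) :
    (line (fun i => C (X i)) X (map ((C : MvPolynomial (Fin n) A →+* _).comp C) F)).coeff
      F.totalDegree = C (homogeneousComponent F.totalDegree F) := by
  rw [coeff_line _ _ (totalDegree_map_le _ _)]
  have h1 : homogeneousComponent F.totalDegree
      (map ((C : MvPolynomial (Fin n) A →+* _).comp C) F) =
      map ((C : MvPolynomial (Fin n) A →+* MvPolynomial (Fin n) (MvPolynomial (Fin n) A)).comp C)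
        (homogeneousComponent F.totalDegree F) := by
    ext1 s
    simp only [coeff_homogeneousComponent, coeff_map]
    split_ifs <;> simp
  have h2 : (eval fun i => (C (X i) : MvPolynomial (Fin n) (MvPolynomial (Fin n) A))).comp
      (map (C.comp C)) = C := by ext <;> simp
  rw [h1]
  exact congrArg (fun φ => φ (homogeneousComponent F.totalDegree F)) h2

/-- Projection along a generic direction, whose coordinates are adjoined to the coefficients. -/
theorem exists_generic_projection {A : Type} [CommRing A] [IsDomain A]
    {F : MvPolynomial (Fin n) A} (hF : F ≠ 0) :
    ∃ c : MvPolynomial (Fin n) A, c ≠ 0 ∧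
      ∃ F' : MvPolynomial (Fin n) (MvPolynomial (Fin n) A), F' ≠ 0 ∧
        ∀ ψ : MvPolynomial (Fin n) A →+* ℝ, ψ c ≠ 0 →
          IsProjection (map (ψ.comp C) F) (ψ ∘ X) (map ψ F') := by
  classical
  set d := F.totalDegree with hd
  set G : Polynomial (MvPolynomial (Fin n) (MvPolynomial (Fin n) A)) :=
    line (fun i => C (X i)) X (map (C.comp C) F) with hG
  set T := (Finset.range (d + 1)).filter fun r => coeffDisc d r G ≠ 0
  have hcoeff : G.coeff d = C (homogeneousComponent d F) := coeff_line_generic F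
  refine ⟨homogeneousComponent d F, homogeneousComponent_totalDegree_ne_zero hF,
    ∏ r ∈ T, coeffDisc d r G, Finset.prod_ne_zero_iff.2 fun r hr => (Finset.mem_filter.1 hr).2,
    fun ψ hψ => ?_⟩
  set F₁ := map (ψ.comp C) F
  set v : Fin n → ℝ := ψ ∘ X
  have hGmap : G.map (map ψ) = genericLine v F₁ := by
    change _ = line (fun i => C (v i)) X (map C F₁)
    rw [hG, map_line, map_map, map_map]
    congr 2
    · ext; simp [v]
    · ext; simp
    · congr 1; ext; simp
  have hGeval : ∀ z, G.map ((eval z).comp (map ψ)) = line v z F₁ := fun z => by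
    rw [← Polynomial.map_map, hGmap, map_genericLine]
  have hdisc : ∀ r z, eval z (map ψ (coeffDisc d r G)) = coeffDisc d r (line v z F₁) :=
    fun r z => by rw [← hGeval, ← map_coeffDisc]; rfl
  have hnat : (genericLine v F₁).natDegree ≤ d := by
    rw [← hGmap]
    exact Polynomial.natDegree_map_le.trans
      (natDegree_line_le _ _ ((totalDegree_map_le _ _).trans hd.ge))
  have hlead : (genericLine v F₁).coeff d = C (ψ (homogeneousComponent d F)) := by
    rw [← hGmap, Polynomial.coeff_map, hcoeff, map_C]
  have hnat' : (genericLine v F₁).natDegree = d :=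
    Polynomial.natDegree_eq_of_le_of_coeff_ne_zero hnat (by rw [hlead]; simpa using hψ)
  have hunit : IsUnit (genericLine v F₁).leadingCoeff := by
    rw [Polynomial.leadingCoeff, hnat', hlead]
    exact (IsUnit.mk0 _ hψ).map C
  have hdeg : ∀ z, (line v z F₁).natDegree = d := fun z => by
    rw [← map_genericLine, Polynomial.natDegree_map_of_leadingCoeff_ne_zero, hnat']
    rw [Polynomial.leadingCoeff, hnat', hlead]; simpa using hψ
  have hne : ∀ z, line v z F₁ ≠ 0 := fun z h0 => by
    have h1 := congrArg (fun p => Polynomial.coeff p d) h0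
    simp only [← map_genericLine, Polynomial.coeff_map, hlead, eval_C, Polynomial.coeff_zero] at h1
    exact hψ h1
  have hvanish : ∀ z z', (∀ g, g ∣ map ψ (∏ r ∈ T, coeffDisc d r G) →
      (eval z g = 0 ↔ eval z' g = 0)) → ∀ r ≤ d,
      coeffDisc d r (line v z' F₁) = 0 → coeffDisc d r (line v z F₁) = 0 := by
    intro z z' h r hr h0
    by_cases hr0 : coeffDisc d r G = 0
    · rw [← hdisc, hr0, map_zero, map_zero]
    · rw [← hdisc] at h0 ⊢
      refine (h _ ((map ψ).map_dvd (Finset.dvd_prod_of_mem _ ?_))).2 h0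
      exact Finset.mem_filter.2 ⟨Finset.mem_range.2 (by omega), hr0⟩
  refine ⟨hunit, fun z z' h => le_antisymm ?_ ?_, fun z s => ?_, fun w hw z => ?_⟩
  · exact numRoots_le_of_coeffDisc (hdeg z) (hdeg z') (hne z) (hne z') (hvanish z z' h)
  · exact numRoots_le_of_coeffDisc (hdeg z') (hdeg z) (hne z') (hne z)
      (hvanish z' z fun g hg => (h g hg).symm)
  · simp only [map_prod, hdisc, line_add_smul, coeffDisc_comp_X_add_C (hdeg z)]
  · have hl : line v (z + w) F₁ = line v z F₁ := by
      refine Polynomial.funext fun t => ?_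
      rw [eval_line, eval_line, add_right_comm, hw]
    simp only [map_prod, hdisc, hl]

/-- The substitution that makes the coordinates of the first direction into coefficients. -/
noncomputable def consVariables (A : Type) [CommRing A] (k n : ℕ) :
    MvPolynomial (Fin k × Fin n) (MvPolynomial (Fin n) A) →+*
      MvPolynomial (Fin (k + 1) × Fin n) A :=
  eval₂Hom (eval₂Hom C fun i => X (0, i)) fun p => X (p.1.succ, p.2)

theorem consVariables_injective (A : Type) [CommRing A] (k n : ℕ) :
    Function.Injective (consVariables A k n) := by
  set inv : MvPolynomial (Fin (k + 1) × Fin n) A →+*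
      MvPolynomial (Fin k × Fin n) (MvPolynomial (Fin n) A) :=
    eval₂Hom (C.comp C) fun p => Fin.cases (C (X p.2)) (fun j => X (j, p.2)) p.1
  have h : inv.comp (consVariables A k n) = RingHom.id _ := by
    ext <;> simp [inv, consVariables]
  exact Function.LeftInverse.injective (g := inv) fun x => congrArg (fun φ => φ x) h

theorem eval₂_consVariables {A : Type} [CommRing A] {k n : ℕ} (φ : A →+* ℝ)
    (W : Fin (k + 1) × Fin n → ℝ) (p : MvPolynomial (Fin k × Fin n) (MvPolynomial (Fin n) A)) :
    eval₂ φ W (consVariables A k n p) =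
      eval₂ (eval₂Hom φ fun i => W (0, i)) (fun p => W (p.1.succ, p.2)) p := by
  have h : (eval₂Hom φ W).comp (consVariables A k n) =
      eval₂Hom (eval₂Hom φ fun i => W (0, i)) (fun p => W (p.1.succ, p.2)) := by
    ext <;> simp [consVariables]
  exact congrArg (fun φ => φ p) h

/-- Iterated projection along generic directions. -/
theorem exists_generic_projections (k : ℕ) : ∀ {A : Type} [CommRing A] [IsDomain A]
    {F : MvPolynomial (Fin n) A}, F ≠ 0 →
    ∃ q : MvPolynomial (Fin k × Fin n) A, q ≠ 0 ∧ ∀ (φ : A →+* ℝ) (W : Fin k × Fin n → ℝ),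
      eval₂ φ W q ≠ 0 → ∃ G : ℕ → MvPolynomial (Fin n) ℝ, G 0 = map φ F ∧
        ∀ i : Fin k, IsProjection (G i) (fun a => W (i, a)) (G (i + 1)) := by
  induction k with
  | zero => exact fun {A} _ _ F _ => ⟨1, one_ne_zero, fun φ W _ => ⟨fun _ => map φ F, rfl, nofun⟩⟩
  | succ k ih =>
    intro A _ _ F hF
    obtain ⟨c, hc, F', hF', hproj⟩ := exists_generic_projection hF
    obtain ⟨q, hq, hG⟩ := ih hF'
    refine ⟨consVariables A k n (C c * q), ?_, fun φ W hW => ?_⟩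
    · rw [Ne, map_eq_zero_iff _ (consVariables_injective A k n)]
      exact mul_ne_zero (by simpa using hc) hq
    · rw [eval₂_consVariables, eval₂_mul, eval₂_C] at hW
      obtain ⟨G, hG0, hGs⟩ := hG _ _ (right_ne_zero_of_mul hW)
      have hp := hproj _ (left_ne_zero_of_mul hW)
      refine ⟨fun i => Nat.casesOn i (map φ F) G, rfl, fun i => ?_⟩
      refine Fin.cases ?_ (fun j => ?_) i
      · have h1 : (eval₂Hom φ fun i => W (0, i)).comp C = φ := by ext; simp
        have h2 : (eval₂Hom φ fun i => W (0, i)) ∘ X = fun i => W (0, i) := by ext; simp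
        rw [h1, h2] at hp
        simpa [hG0] using hp
      · simpa using hGs j

end Projection

section Tower

variable {n : ℕ} {V : Matrix (Fin n) (Fin n) ℝ} {H : ℕ → MvPolynomial (Fin n) ℝ}
  {U : Type*}

/-- Successive projections along the columns of `V`, starting from the last column. -/
def IsTower (V : Matrix (Fin n) (Fin n) ℝ) (H : ℕ → MvPolynomial (Fin n) ℝ) : Prop :=
  ∀ j : Fin n, IsProjection (H (j + 1)) (V.col j) (H j)

theorem mulVec_add_single (V : Matrix (Fin n) (Fin n) ℝ) (x : Fin n → ℝ) (j : Fin n) (s : ℝ) :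
    V.mulVec (x + Pi.single j s) = V.mulVec x + s • V.col j := by
  rw [Matrix.mulVec_add, Matrix.mulVec_single]
  simp

theorem IsTower.eval_add (h : IsTower V H) {j : ℕ} (hj : j ≤ n) :
    ∀ {w : Fin n → ℝ}, (∀ i : Fin n, (i : ℕ) < j → w i = 0) → ∀ z,
      eval (z + V.mulVec w) (H j) = eval z (H j) := by
  induction hj using Nat.decreasingInduction with
  | self =>
    intro w hw z
    have hw0 : w = 0 := funext fun i => hw i i.2
    simp [hw0]
  | of_succ k hk ih =>
    intro w hw z
    set w' := Function.update w ⟨k, hk⟩ 0 with hw'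
    have hsplit : w = w' + Pi.single ⟨k, hk⟩ (w ⟨k, hk⟩) := by
      ext i
      by_cases hi : i = ⟨k, hk⟩
      · subst hi; simp [hw']
      · simp [hw', hi]
    have hinv : ∀ z, eval (z + V.mulVec w') (H (k + 1)) = eval z (H (k + 1)) := by
      refine ih fun i hi => ?_
      by_cases hik : i = ⟨k, hk⟩
      · simp [hw', hik]
      · have : (i : ℕ) ≠ k := fun h => hik (Fin.ext h)
        simp [hw', hik, hw i (by omega)]
    rw [hsplit, mulVec_add_single, ← add_assoc, (h ⟨k, hk⟩).eval_add_smul,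
      (h ⟨k, hk⟩).eval_add _ hinv]

theorem IsTower.eval_congr (h : IsTower V H) {j : ℕ} (hj : j ≤ n) {x y : Fin n → ℝ}
    (hxy : ∀ i : Fin n, (i : ℕ) < j → x i = y i) :
    eval (V.mulVec x) (H j) = eval (V.mulVec y) (H j) := by
  have := h.eval_add hj (w := x - y) (fun i hi => by simp [hxy i hi]) (V.mulVec y)
  rwa [← Matrix.mulVec_add, add_sub_cancel] at this

/-- The vanishing of every divisor of `G` is constant along `σ`. -/
def ConstVanishing (G : MvPolynomial (Fin n) ℝ) (σ : U → Fin n → ℝ) : Prop :=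
  ∀ g, g ∣ G → ∀ u u', eval (σ u) g = 0 ↔ eval (σ u') g = 0

theorem constVanishing_of_ne_zero {G : MvPolynomial (Fin n) ℝ} {σ : U → Fin n → ℝ}
    (h : ∀ u, eval (σ u) G ≠ 0) : ConstVanishing G σ := by
  have hne : ∀ g, g ∣ G → ∀ u, eval (σ u) g ≠ 0 := fun g hg u h0 =>
    h u (zero_dvd_iff.1 (h0 ▸ (eval (σ u)).map_dvd hg))
  exact fun g hg u u' => iff_of_false (hne g hg u) (hne g hg u')

theorem exists_bound_eval {σ : U → Fin n → ℝ} (hσ : Bornology.IsBounded (range σ))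
    (G : MvPolynomial (Fin n) ℝ) : ∃ B, ∀ u, |eval (σ u) G| ≤ B := by
  obtain ⟨B, hB⟩ := (hσ.isCompact_closure.image (MvPolynomial.continuous_eval G)).isBounded
    |>.exists_norm_le
  exact ⟨B, fun u => hB _ ⟨σ u, subset_closure ⟨u, rfl⟩, rfl⟩⟩

theorem IsTower.exists_lift [TopologicalSpace U] [PreconnectedSpace U] (h : IsTower V H)
    {j m : ℕ} (hjm : j ≤ m) (hm : m ≤ n) {ξ : U → Fin n → ℝ} (hξ : Continuous ξ)
    (hvan : ConstVanishing (H j) fun u => V.mulVec (ξ u)) (u₀ : U) {y₀ : Fin n → ℝ}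
    (hy₀ : ∀ i : Fin n, (i : ℕ) < j → ξ u₀ i = y₀ i) :
    ∃ ξ' : U → Fin n → ℝ, Continuous ξ' ∧ (∀ u (i : Fin n), (i : ℕ) < j → ξ' u i = ξ u i) ∧
      (∀ i : Fin n, (i : ℕ) < m → ξ' u₀ i = y₀ i) ∧
      (Bornology.IsBounded (range ξ) → Bornology.IsBounded (range ξ')) ∧
      ConstVanishing (H m) fun u => V.mulVec (ξ' u) := by
  induction m, hjm using Nat.le_induction with
  | base => exact ⟨ξ, hξ, fun _ _ _ => rfl, hy₀, id, hvan⟩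
  | succ m hjm ih =>
    obtain ⟨ξ', hξ', hagree, hu₀, hbdd, hvan'⟩ := ih (by omega)
    set k : Fin n := ⟨m, hm⟩
    have hproj : IsProjection (H (m + 1)) (V.col k) (H m) := h k
    have hcont : Continuous fun u => V.mulVec (ξ' u) := continuous_const.matrix_mulVec hξ'
    obtain ⟨d, c, hfam⟩ := isPolyFamily_line (U := U) hproj.isUnit
    have hf := hfam _ hcont
    obtain ⟨η, hη, hηu₀, hroot, hηb⟩ := hf.exists_section
      (fun u u' => hproj.numRoots_eq _ _ fun g hg => hvan' g hg u u') u₀ (y₀ k - ξ' u₀ k)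
    have heval : ∀ g u, eval (V.mulVec (ξ' u + Pi.single k (η u))) g =
        (line (V.col k) (V.mulVec (ξ' u)) g).eval (η u) := fun g u => by
      rw [mulVec_add_single, eval_line]
    refine ⟨fun u => ξ' u + Pi.single k (η u), ?_, fun u i hi => ?_, fun i hi => ?_,
      fun hb => ?_, ?_⟩
    · exact hξ'.add ((continuous_single k).comp hη)
    · have hik : i ≠ k := fun hik => by rw [hik] at hi; simp only [k] at hi; omega
      simp [hik, hagree u i hi]
    · by_cases hik : i = k
      · simp [hik, hηu₀]
      · have : (i : ℕ) ≠ m := fun h => hik (Fin.ext h)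
        simp [hik, hu₀ i (by omega)]
    · have hb' : Bornology.IsBounded (range fun u => V.mulVec (ξ' u)) := by
        refine (((hbdd hb).isCompact_closure.image
          ((continuous_const (y := V)).matrix_mulVec continuous_id)).isBounded).subset ?_
        rintro _ ⟨u, rfl⟩
        exact ⟨ξ' u, subset_closure ⟨u, rfl⟩, rfl⟩
      obtain ⟨B, hB⟩ := hηb fun i => by
        simp only [← map_genericLine, Polynomial.coeff_map]
        exact exists_bound_eval hb' _
      obtain ⟨B', hB'⟩ := (hbdd hb).exists_norm_le
      refine isBounded_iff_forall_norm_le.2 ⟨B' + B, ?_⟩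
      rintro _ ⟨u, rfl⟩
      refine (norm_add_le _ _).trans (add_le_add (hB' _ ⟨u, rfl⟩) ?_)
      rw [Pi.norm_single]
      exact hB u
    · rcases hroot with hroot | hroot
      · intro g hg u u'
        simp only [heval]
        obtain ⟨d', c', hfam'⟩ :=
          isPolyFamily_line (U := U) (isUnit_leadingCoeff_of_dvd hproj.isUnit hg)
        exact hf.factor_eval_eq_zero_iff
          (fun u u' => hproj.numRoots_eq _ _ fun g hg => hvan' g hg u u') (hfam' _ hcont)
          (fun u => map_dvd _ hg) hη hroot u u'
      · refine constVanishing_of_ne_zero fun u => ?_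
        simp only [heval]
        exact hroot u

end Tower

section Components

variable {n : ℕ} {V : Matrix (Fin n) (Fin n) ℝ} {H : ℕ → MvPolynomial (Fin n) ℝ}
  {P : Set (Fin n → ℝ)} {p x₀ : Fin n → ℝ}

open Filter Topology

/-- The points of `ℝⁿ` that agree with `p` in the first `k` coordinates. -/
def slice (p : Fin n → ℝ) (k : ℕ) : Set (Fin n → ℝ) := {x | ∀ j : Fin n, (j : ℕ) < k → x j = p j}

/-- Membership in `P` is constant along every path on which the vanishing of the divisors of `F`
is constant. -/
def IsAdapted (V : Matrix (Fin n) (Fin n) ℝ) (F : MvPolynomial (Fin n) ℝ) (P : Set (Fin n → ℝ)) :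
    Prop :=
  ∀ {U : Type} [TopologicalSpace U] [PreconnectedSpace U] (ξ : U → Fin n → ℝ), Continuous ξ →
    ConstVanishing F (fun u => V.mulVec (ξ u)) → ∀ u u', ξ u ∈ P → ξ u' ∈ P

theorem IsTower.exists_lift_component {U : Type} [TopologicalSpace U] [PreconnectedSpace U]
    (h : IsTower V H) (hP : IsAdapted V (H n) P) {k j : ℕ} (hkj : k ≤ j) (hj : j ≤ n)
    {y : Fin n → ℝ} (hy : y ∈ connectedComponentIn (P ∩ slice p k) x₀) {ξ : U → Fin n → ℝ}
    (hξ : Continuous ξ) (hne : ∀ u, eval (V.mulVec (ξ u)) (H j) ≠ 0)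
    (hslice : ∀ u (i : Fin n), (i : ℕ) < k → ξ u i = p i) (u₀ : U)
    (hu₀ : ∀ i : Fin n, (i : ℕ) < j → ξ u₀ i = y i) :
    ∃ ξ' : U → Fin n → ℝ, (∀ u (i : Fin n), (i : ℕ) < j → ξ' u i = ξ u i) ∧
      (∀ u, ξ' u ∈ connectedComponentIn (P ∩ slice p k) x₀) ∧
      (Bornology.IsBounded (range ξ) → Bornology.IsBounded (range ξ')) := by
  obtain ⟨ξ', hξ', hagree, hξu₀, hbdd, hvan⟩ :=
    h.exists_lift hj le_rfl hξ (constVanishing_of_ne_zero hne) u₀ hu₀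
  have hstart : ξ' u₀ = y := funext fun i => hξu₀ i i.2
  refine ⟨ξ', hagree, fun u => ?_, hbdd⟩
  have hyP := connectedComponentIn_subset _ _ hy
  rw [connectedComponentIn_eq hy]
  refine (isPreconnected_range hξ').subset_connectedComponentIn ⟨u₀, hstart⟩ ?_ ⟨u, rfl⟩
  rintro _ ⟨u', rfl⟩
  refine ⟨hP ξ' hξ' hvan u₀ u' (hstart ▸ hyP.1), fun i hi => ?_⟩
  rw [hagree u' i (by omega), hslice u' i hi]

theorem IsTower.exists_lt_gt (h : IsTower V H) (hP : IsAdapted V (H n) P) {k : Fin n} {j : ℕ}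
    (hkj : (k : ℕ) < j) (hj : j ≤ n) {x : Fin n → ℝ}
    (hx : x ∈ closure (connectedComponentIn (P ∩ slice p k) x₀))
    (hne : eval (V.mulVec x) (H j) ≠ 0) :
    (∃ a ∈ connectedComponentIn (P ∩ slice p k) x₀, a k < x k) ∧
      ∃ b ∈ connectedComponentIn (P ∩ slice p k) x₀, x k < b k := by
  have hcont : Continuous fun w : (Fin n → ℝ) × ℝ =>
      eval (V.mulVec (w.1 + Pi.single k w.2)) (H j) :=
    (MvPolynomial.continuous_eval _).comp (continuous_const.matrix_mulVec
      (continuous_fst.add ((continuous_single k).comp continuous_snd)))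
  have hne' : eval (V.mulVec (x + Pi.single k 0)) (H j) ≠ 0 := by
    rwa [Pi.single_zero, add_zero]
  obtain ⟨ε, hε, hball⟩ := Metric.eventually_nhds_iff.1
    ((hcont.tendsto (x, 0)).eventually_ne hne')
  obtain ⟨y, hy, hxy⟩ := Metric.mem_closure_iff.1 hx (ε / 2) (half_pos hε)
  have hyk : |x k - y k| < ε / 2 := (dist_le_pi_dist x y k).trans_lt hxy
  have hys : ∀ i : Fin n, (i : ℕ) < k → y i = p i := (connectedComponentIn_subset _ _ hy).2
  have hpos := half_pos hε
  have : PreconnectedSpace (Icc (-(ε / 2)) (ε / 2)) := Subtype.preconnectedSpace isPreconnected_Icc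
  set ξ : Icc (-(ε / 2)) (ε / 2) → Fin n → ℝ := fun u => y + Pi.single k u.1 with hξdef
  have hξ : Continuous ξ :=
    continuous_const.add ((continuous_single k).comp continuous_subtype_val)
  have hξne : ∀ u, eval (V.mulVec (ξ u)) (H j) ≠ 0 := fun u => by
    have h1 : |u.1| < ε := (abs_le.2 u.2).trans_lt (half_lt_self hε)
    have h2 : dist y x < ε := by rw [dist_comm]; exact hxy.trans (half_lt_self hε)
    have h3 : dist (y, u.1) (x, (0 : ℝ)) < ε := by
      rw [Prod.dist_eq]
      exact max_lt h2 (by simpa using h1)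
    have h4 := hball h3
    simpa only [hξdef] using h4
  have hξi : ∀ u (i : Fin n), (i : ℕ) < k → ξ u i = p i := fun u i hi => by
    have hik : i ≠ k := fun hik => by rw [hik] at hi; exact lt_irrefl _ hi
    simp [hξdef, hik, hys i hi]
  obtain ⟨ξ', hagree, hmem, -⟩ := h.exists_lift_component hP hkj.le hj hy hξ hξne hξi
    ⟨0, by constructor <;> linarith⟩ (by simp [hξdef])
  have hcoord : ∀ u, ξ' u k = y k + u.1 := fun u => by
    simp [hagree u k hkj, hξdef]
  obtain ⟨h1, h2⟩ := abs_lt.1 hyk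
  refine ⟨⟨_, hmem ⟨-(ε / 2), by constructor <;> linarith⟩, ?_⟩,
    ⟨_, hmem ⟨ε / 2, by constructor <;> linarith⟩, ?_⟩⟩
  · rw [hcoord]; simp only; linarith
  · rw [hcoord]; simp only; linarith

theorem IsTower.eval_eq_zero_of_mem_ZZ (h : IsTower V H) (hP : IsAdapted V (H n) P) {k : Fin n}
    {x : Fin n → ℝ} (hx : x ∈ ZZ (connectedComponentIn (P ∩ slice p k) x₀) k) {j : ℕ}
    (hkj : (k : ℕ) < j) (hj : j ≤ n) : eval (V.mulVec x) (H j) = 0 := by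
  by_contra hne
  rcases hx with ⟨hx, hb, hxk⟩ | ⟨hx, hb, hxk⟩
  · obtain ⟨⟨a, ha, hlt⟩, -⟩ := h.exists_lt_gt hP hkj hj hx hne
    exact hlt.not_ge (hxk ▸ csInf_le hb ⟨a, ha, rfl⟩)
  · obtain ⟨-, b, hb', hlt⟩ := h.exists_lt_gt hP hkj hj hx hne
    exact hlt.not_ge (hxk ▸ le_csSup hb ⟨b, hb', rfl⟩)

theorem isClosed_slice (p : Fin n → ℝ) (k : ℕ) : IsClosed (slice p k) := by
  simp only [slice, ofPred_forall]
  exact isClosed_iInter fun j => isClosed_iInter fun _ =>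
    isClosed_eq (continuous_apply j) continuous_const

theorem mem_slice_of_mem_ZZ {k : Fin n} {x : Fin n → ℝ}
    (hx : x ∈ ZZ (connectedComponentIn (P ∩ slice p k) x₀) k) : x ∈ slice p k := by
  have hcl : x ∈ closure (connectedComponentIn (P ∩ slice p k) x₀) := hx.elim And.left And.left
  exact closure_minimal ((connectedComponentIn_subset _ _).trans inter_subset_right)
    (isClosed_slice p k) hcl

theorem IsTower.line_ne_zero (h : IsTower V H) (k : Fin n) (z : Fin n → ℝ) :
    line (V.col k) z (H (k + 1)) ≠ 0 := by
  obtain ⟨d, c, hfam⟩ := isPolyFamily_line (U := Unit) (h k).isUnit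
  exact (hfam (fun _ => z) continuous_const).apply_ne_zero ()

theorem IsTower.finite_zeros (h : IsTower V H) (p : Fin n → ℝ) {k m : ℕ} (hkm : k ≤ m)
    (hm : m ≤ n) :
    {x | x ∈ slice p k ∧ (∀ i : Fin n, m ≤ i → x i = 0) ∧
      ∀ j, k < j → j ≤ m → eval (V.mulVec x) (H j) = 0}.Finite := by
  induction m, hkm using Nat.le_induction with
  | base =>
    refine Set.Subsingleton.finite fun x hx y hy => funext fun i => ?_
    rcases lt_or_ge (i : ℕ) k with hi | hi
    · rw [hx.1 i hi, hy.1 i hi]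
    · rw [hx.2.1 i hi, hy.2.1 i hi]
  | succ m hkm ih =>
    set a : Fin n := ⟨m, hm⟩
    refine ((ih (by omega)).biUnion fun x' _ => (Polynomial.finite_setOfPred_isRoot
      (h.line_ne_zero a (V.mulVec x'))).image fun t => x' + Pi.single a t).subset ?_
    rintro x ⟨hxs, hx0, hxe⟩
    have hsplit : Function.update x a 0 + Pi.single a (x a) = x := by
      ext i
      by_cases hi : i = a
      · subst hi; simp
      · simp [hi]
    have hupd : ∀ i : Fin n, (i : ℕ) < m → Function.update x a 0 i = x i := fun i hi =>
      Function.update_of_ne (fun hia => by rw [hia] at hi; exact lt_irrefl _ hi) _ _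
    refine mem_biUnion (x := Function.update x a 0) ⟨fun i hi => ?_, fun i hi => ?_,
      fun j hj hjm => ?_⟩ ⟨x a, ?_, hsplit⟩
    · rw [hupd i (by omega), hxs i hi]
    · by_cases hia : i = a
      · simp [hia]
      · have : (i : ℕ) ≠ m := fun h => hia (Fin.ext h)
        simp [hia, hx0 i (by omega)]
    · rw [h.eval_congr (by omega) (y := x) fun i hi => hupd i (by omega)]
      exact hxe j hj (by omega)
    · change Polynomial.eval _ _ = 0
      rw [eval_line, ← mulVec_add_single, hsplit]
      exact hxe (m + 1) (by omega) le_rfl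

theorem IsTower.exists_mem_closure (h : IsTower V H) (hP : IsAdapted V (H n) P) {k : Fin n}
    {c : ℝ} (hc : c ∈ closure (projK k (connectedComponentIn (P ∩ slice p k) x₀))) :
    ∃ x ∈ closure (connectedComponentIn (P ∩ slice p k) x₀), x k = c := by
  set C := connectedComponentIn (P ∩ slice p k) x₀
  set z := Function.update p k 0
  have hfin := (Polynomial.finite_setOfPred_isRoot (h.line_ne_zero k (V.mulVec z))).subset
    (sdiff_subset (t := {c}))
  obtain ⟨ε, hε, hball⟩ := Metric.isOpen_iff.1 hfin.isClosed.isOpen_compl c (by simp)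
  obtain ⟨_, ⟨y, hy, rfl⟩, hyc⟩ := Metric.mem_closure_iff.1 hc ε hε
  by_cases hyk : y k = c
  · exact ⟨y, subset_closure hy, hyk⟩
  have hys : ∀ i : Fin n, (i : ℕ) < k → y i = p i := (connectedComponentIn_subset _ _ hy).2
  set ξ : Ioc (0 : ℝ) 1 → Fin n → ℝ := fun τ => y + Pi.single k ((1 - τ.1) * (c - y k)) with hξdef
  have hξ : Continuous ξ := continuous_const.add ((continuous_single k).comp (by fun_prop))
  have hξk : ∀ τ, ξ τ k = c - τ.1 * (c - y k) := fun τ => by simp [hξdef]; ring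
  have hξi : ∀ τ (i : Fin n), (i : ℕ) < k → ξ τ i = p i := fun τ i hi => by
    have hik : i ≠ k := fun hik => by rw [hik] at hi; exact lt_irrefl _ hi
    simp [hξdef, hik, hys i hi]
  have hne : ∀ τ, eval (V.mulVec (ξ τ)) (H (k + 1)) ≠ 0 := by
    intro τ h0
    have hcongr : eval (V.mulVec (ξ τ)) (H (k + 1)) =
        eval (V.mulVec (z + Pi.single k (ξ τ k))) (H (k + 1)) := by
      refine h.eval_congr k.2 fun i hi => ?_
      by_cases hik : i = k
      · subst hik; simp [z]
      · have : (i : ℕ) ≠ k := fun h => hik (Fin.ext h)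
        simp [hik, z, hξi τ i (by omega)]
    rw [hcongr, mulVec_add_single, ← eval_line] at h0
    have hmem : ξ τ k ∈ Metric.ball c ε := by
      rw [Metric.mem_ball, Real.dist_eq, hξk]
      have h1 : |c - y k| < ε := hyc
      have h2 : |τ.1| ≤ 1 := abs_le.2 ⟨by linarith [τ.2.1], τ.2.2⟩
      have h3 : c - τ.1 * (c - y k) - c = -(τ.1 * (c - y k)) := by ring
      rw [h3, abs_neg, abs_mul]
      exact (mul_le_of_le_one_left (abs_nonneg _) h2).trans_lt h1
    refine hball hmem ⟨h0, fun hmc => ?_⟩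
    have h4 : τ.1 * (c - y k) = 0 := by
      have := hξk τ
      rw [mem_singleton_iff.1 hmc] at this
      linarith
    rcases mul_eq_zero.1 h4 with h5 | h5
    · exact τ.2.1.ne' h5
    · exact hyk (by linarith)
  have : PreconnectedSpace (Ioc (0 : ℝ) 1) := Subtype.preconnectedSpace isPreconnected_Ioc
  obtain ⟨ξ', hagree, hmem, hbdd⟩ := h.exists_lift_component hP (Nat.le_succ _) k.2 hy hξ hne hξi
    ⟨1, by simp⟩ (by simp [hξdef])
  have hb : Bornology.IsBounded (range ξ) := by
    have hext : Continuous fun τ : ℝ => y + Pi.single k ((1 - τ) * (c - y k)) :=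
      continuous_const.add ((continuous_single k).comp (by fun_prop))
    refine ((isCompact_Icc (a := (0 : ℝ)) (b := 1)).image hext).isBounded.subset ?_
    rintro _ ⟨τ, rfl⟩
    exact ⟨τ.1, Ioc_subset_Icc_self τ.2, rfl⟩
  set τ : ℕ → Ioc (0 : ℝ) 1 := fun i => ⟨1 / ((i : ℝ) + 1), by positivity, by
    rw [div_le_one (by positivity)]; linarith [(Nat.cast_nonneg i : (0 : ℝ) ≤ i)]⟩
  obtain ⟨x, -, φ, hφ, hx⟩ := tendsto_subseq_of_bounded (hbdd hb) (x := fun i => ξ' (τ i))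
    fun i => ⟨τ i, rfl⟩
  refine ⟨x, mem_closure_of_tendsto hx (Eventually.of_forall fun i => hmem _), ?_⟩
  refine tendsto_nhds_unique (((continuous_apply k).tendsto x).comp hx) ?_
  have hτ : Tendsto (fun i => c - (τ (φ i)).1 * (c - y k)) atTop (𝓝 (c - 0 * (c - y k))) :=
    ((tendsto_one_div_add_atTop_nhds_zero_nat.comp hφ.tendsto_atTop).mul_const _).const_sub c
  rw [zero_mul, sub_zero] at hτ
  refine hτ.congr fun i => ?_
  simp only [Function.comp]
  rw [hagree _ k (Nat.lt_succ_self _), hξk]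

/-- The points sampled from `P` with base point `p`. -/
def samplePoints (P : Set (Fin n → ℝ)) (p : Fin n → ℝ) : Set (Fin n → ℝ) :=
  {p} ∪ ⋃ (k : Fin n), ⋃ x₀ ∈ P ∩ slice p k, ZZ (connectedComponentIn (P ∩ slice p k) x₀) k

theorem IsTower.finite_samplePoints (h : IsTower V H) (hP : IsAdapted V (H n) P) :
    (samplePoints P p).Finite := by
  refine (finite_singleton p).union (finite_iUnion fun k => ?_)
  refine (h.finite_zeros p k.2.le le_rfl).subset (iUnion₂_subset fun x₀ _ x hx => ?_)
  exact ⟨mem_slice_of_mem_ZZ hx, fun i hi => absurd i.2 hi.not_gt, fun j hkj hj =>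
    h.eval_eq_zero_of_mem_ZZ hP hx hkj hj⟩

theorem IsTower.nonempty_ZZ (h : IsTower V H) (hP : IsAdapted V (H n) P) {k : Fin n}
    (hx₀ : x₀ ∈ P ∩ slice p k)
    (hb : BddBelow (projK k (connectedComponentIn (P ∩ slice p k) x₀)) ∨
      BddAbove (projK k (connectedComponentIn (P ∩ slice p k) x₀))) :
    (ZZ (connectedComponentIn (P ∩ slice p k) x₀) k).Nonempty := by
  have hne : (projK k (connectedComponentIn (P ∩ slice p k) x₀)).Nonempty :=
    ⟨_, x₀, mem_connectedComponentIn hx₀, rfl⟩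
  rcases hb with hb | hb
  · obtain ⟨x, hx, hxk⟩ := h.exists_mem_closure hP (csInf_mem_closure hne hb)
    exact ⟨x, Or.inl ⟨hx, hb, hxk⟩⟩
  · obtain ⟨x, hx, hxk⟩ := h.exists_mem_closure hP (csSup_mem_closure hne hb)
    exact ⟨x, Or.inr ⟨hx, hb, hxk⟩⟩

theorem IsTower.samplePoints_inter_closure (h : IsTower V H) (hP : IsAdapted V (H n) P)
    {x : Fin n → ℝ} (hx : x ∈ P) :
    (samplePoints P p ∩ closure (connectedComponentIn P x)).Nonempty := by
  by_contra hempty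
  have key : ∀ k ≤ n, ∃ x₀ ∈ connectedComponentIn P x, x₀ ∈ slice p k := by
    intro k
    induction k with
    | zero => exact fun _ => ⟨x, mem_connectedComponentIn hx, fun j hj => absurd hj (by omega)⟩
    | succ k ih =>
      intro hk
      obtain ⟨x₀, hx₀, hs⟩ := ih (by omega)
      have hx₀' : x₀ ∈ P ∩ slice p k := ⟨connectedComponentIn_subset _ _ hx₀, hs⟩
      set C := connectedComponentIn (P ∩ slice p k) x₀ with hC
      have hsub : C ⊆ connectedComponentIn P x := by
        rw [connectedComponentIn_eq hx₀]
        exact connectedComponentIn_mono _ inter_subset_left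
      set a : Fin n := ⟨k, hk⟩
      have hunb : ¬ (BddBelow (projK a C) ∨ BddAbove (projK a C)) := by
        intro hb
        obtain ⟨w, hw⟩ := h.nonempty_ZZ hP (k := a) hx₀' hb
        exact hempty ⟨w, Or.inr (mem_iUnion.2 ⟨a, mem_iUnion₂.2 ⟨x₀, hx₀', hw⟩⟩),
          closure_mono hsub (hw.elim And.left And.left)⟩
      rw [not_or, not_bddBelow_iff, not_bddAbove_iff] at hunb
      obtain ⟨l, hl, hlp⟩ := hunb.1 (p a)
      obtain ⟨u, hu, hup⟩ := hunb.2 (p a)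
      have hconn : IsPreconnected (projK a C) :=
        isPreconnected_connectedComponentIn.image _ (continuous_apply a).continuousOn
      obtain ⟨y, hy, hya⟩ := hconn.ordConnected.out hl hu ⟨hlp.le, hup.le⟩
      refine ⟨y, hsub hy, fun i hi => ?_⟩
      by_cases hia : i = a
      · rw [hia]; exact hya
      · have : (i : ℕ) ≠ k := fun h => hia (Fin.ext h)
        exact (connectedComponentIn_subset _ _ hy).2 i (by omega)
  obtain ⟨x₀, hx₀, hs⟩ := key n le_rfl
  have hxp : x₀ = p := funext fun i => hs i i.2
  exact hempty ⟨p, Or.inl rfl, subset_closure (hxp ▸ hx₀)⟩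

end Components

theorem mem_iff_of_inBoolAlg {α : Type*} {G : Set (Set α)} {P : Set α} (hP : InBoolAlg G P)
    {x y : α} (h : ∀ S ∈ G, (x ∈ S ↔ y ∈ S)) : x ∈ P ↔ y ∈ P := by
  induction hP with
  | basic S hS => exact h S hS
  | compl S _ ih => exact not_congr ih
  | union S T _ _ ihS ihT => exact or_congr ihS ihT
  | inter S T _ _ ihS ihT => exact and_congr ihS ihT

theorem ConstVanishing.pos_of_pos {n : ℕ} {U : Type*} [TopologicalSpace U] [PreconnectedSpace U]
    {F g : MvPolynomial (Fin n) ℝ} {σ : U → Fin n → ℝ} (hF : ConstVanishing F σ)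
    (hσ : Continuous σ) (hg : g ∣ F) {u u' : U} (hu : 0 < eval (σ u) g) : 0 < eval (σ u') g := by
  by_contra hu'
  obtain ⟨w, hw⟩ := mem_range_of_exists_le_of_exists_ge
    ((MvPolynomial.continuous_eval g).comp hσ) ⟨u', not_lt.1 hu'⟩ ⟨u, hu.le⟩
  exact hu.ne' ((hF g hg w u).1 hw)

theorem isAdapted_of_inBoolAlg {n m : ℕ} {V : Matrix (Fin n) (Fin n) ℝ}
    {f : Fin m → MvPolynomial (Fin n) ℝ} {F : MvPolynomial (Fin n) ℝ}
    (hf : ∀ i, f i ≠ 0 → f i ∣ F) {P : Set (Fin n → ℝ)}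
    (hP : InBoolAlg {S | ∃ i : Fin m, S = {x | 0 < eval (V.mulVec x) (f i)} ∨
      S = {x | eval (V.mulVec x) (f i) = 0}} P) : IsAdapted V F P := by
  intro U _ _ ξ hξ hvan u u'
  refine (mem_iff_of_inBoolAlg hP ?_).1
  rintro S ⟨i, hS⟩
  by_cases hi : f i = 0
  · rcases hS with rfl | rfl <;> simp [hi]
  have hcont : Continuous fun u => V.mulVec (ξ u) := continuous_const.matrix_mulVec hξ
  rcases hS with rfl | rfl
  · exact ⟨hvan.pos_of_pos hcont (hf i hi), hvan.pos_of_pos hcont (hf i hi)⟩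
  · exact hvan (f i) (hf i hi) u u'

/-- A generic matrix is invertible and has a tower over a given nonzero polynomial. -/
theorem exists_generic_tower {n : ℕ} {F : MvPolynomial (Fin n) ℝ} (hF : F ≠ 0) :
    ∃ q : MvPolynomial (Fin n × Fin n) ℝ, q ≠ 0 ∧ ∀ V : Matrix (Fin n) (Fin n) ℝ,
      eval (fun ij => V ij.1 ij.2) q ≠ 0 → V.det ≠ 0 ∧ ∃ H, H n = F ∧ IsTower V H := by
  obtain ⟨q, hq, hG⟩ := exists_generic_projections n hF
  set e : Fin n × Fin n → Fin n × Fin n := fun w => (w.2, w.1.rev) with he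
  have hinj : Function.Injective e := by
    rintro ⟨a, b⟩ ⟨c, d⟩ h
    simp only [he, Prod.mk.injEq, Fin.rev_inj] at h
    rw [h.1, h.2]
  refine ⟨rename e q * (Matrix.mvPolynomialX (Fin n) (Fin n) ℝ).det, mul_ne_zero ?_
    (Matrix.det_mvPolynomialX_ne_zero _ _), fun V hV => ?_⟩
  · rwa [Ne, map_eq_zero_iff _ (rename_injective e hinj)]
  rw [map_mul] at hV
  refine ⟨fun h0 => right_ne_zero_of_mul hV ?_, ?_⟩
  · rw [RingHom.map_det, ← h0]
    congr 1
    ext i j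
    simp
  · have hq' := left_ne_zero_of_mul hV
    rw [eval_rename] at hq'
    obtain ⟨G, hG0, hGs⟩ := hG (RingHom.id ℝ) _ (by rwa [eval₂_id])
    refine ⟨fun j => G (n - j), by simp [hG0, map_id], fun j => ?_⟩
    have h := hGs j.rev
    have h1 : (j.rev : ℕ) = n - (j + 1) := Fin.val_rev j
    have h2 : (j.rev : ℕ) + 1 = n - j := by have := j.2; omega
    rw [h2, h1] at h
    simp only [he, Function.comp, Fin.rev_rev] at h
    exact h

end Sampling

theorem statement1 (n m : ℕ) (f : Fin m → MvPolynomial (Fin n) ℝ) :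
    ∃ q : MvPolynomial (Fin n × Fin n) ℝ, q ≠ 0 ∧
      ∀ V : Matrix (Fin n) (Fin n) ℚ,
        eval (fun ij => ((V ij.1 ij.2 : ℚ) : ℝ)) q ≠ 0 →
          IsUnit V ∧
          ∀ P : Set (Fin n → ℝ),
            InBoolAlg {S | ∃ i : Fin m,
                S = {x | 0 < eval ((V.map ((↑) : ℚ → ℝ)).mulVec x) (f i)} ∨
                S = {x | eval ((V.map ((↑) : ℚ → ℝ)).mulVec x) (f i) = 0}} P →
            ∀ p : Fin n → ℝ,
              ∀ Mset : Set (Fin n → ℝ),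
                Mset = {p} ∪ ⋃ (k : Fin n),
                    ⋃ x₀ ∈ P ∩ {x | ∀ j : Fin n, j < k → x j = p j},
                      ZZ (connectedComponentIn
                        (P ∩ {x | ∀ j : Fin n, j < k → x j = p j}) x₀) k →
                  Mset.Finite ∧
                  ∀ x ∈ P, (Mset ∩ closure (connectedComponentIn P x)).Nonempty := by
  classical
  set F := ∏ i with f i ≠ 0, f i
  have hF : F ≠ 0 := Finset.prod_ne_zero_iff.2 fun i hi => (Finset.mem_filter.1 hi).2
  have hdvd : ∀ i, f i ≠ 0 → f i ∣ F := fun i hi =>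
    Finset.dvd_prod_of_mem f (Finset.mem_filter.2 ⟨Finset.mem_univ i, hi⟩)
  obtain ⟨q, hq, hgen⟩ := Sampling.exists_generic_tower hF
  refine ⟨q, hq, fun V hV => ?_⟩
  obtain ⟨hdet, H, hH, hT⟩ := hgen (V.map ((↑) : ℚ → ℝ)) hV
  refine ⟨?_, fun P hP p Mset hM => ?_⟩
  · rw [Matrix.isUnit_iff_isUnit_det, isUnit_iff_ne_zero]
    intro h0
    have h1 : ((V.det : ℚ) : ℝ) = (V.map ((↑) : ℚ → ℝ)).det := (Rat.castHom ℝ).map_det V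
    rw [h0, Rat.cast_zero] at h1
    exact hdet h1.symm
  · have hA : Sampling.IsAdapted (V.map ((↑) : ℚ → ℝ)) (H n) P :=
      hH ▸ Sampling.isAdapted_of_inBoolAlg hdvd hP
    have hM' : Mset = Sampling.samplePoints P p := hM
    subst hM'
    exact ⟨hT.finite_samplePoints hA, fun x hx => hT.samplePoints_inter_closure hA hx⟩
end
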